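/- arXiv:1110.2559 — 2 statements merged into one kernel-verified Lean document; each statement's English description precedes it below -/
import Mathlib

section
/- Let Q1 and Q2 be nonzero square-free binary sextics, and let 𝐐1 and 𝐐2 be binary octavics associated to Q1 and Q2 respectively. If 𝐐1 and 𝐐2 are linearly equivalent up to scale, i.e., there exist c ∈ ℂ∖{0} and C ∈ GL(2,ℂ) such that c·𝐐1(C·(w1,w2)) = 𝐐2(w1,w2) as polynomials, then Q1 and Q2 are linearly equivalent. -/
open MvPolynomial

/-- The polynomial obtained from `Q(z)` by the linear change of variables `z ↦ M z`;
its value at `w` is `Q (M w)`. -/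
noncomputable def substMat (M : Matrix (Fin 2) (Fin 2) ℂ) (Q : MvPolynomial (Fin 2) ℂ) :
    MvPolynomial (Fin 2) ℂ :=
  aeval (fun i => MvPolynomial.C (M i 0) * X 0 + MvPolynomial.C (M i 1) * X 1) Q

/-- Two binary forms are linearly equivalent if one is obtained from the other by an
invertible linear change of the variables. -/
def LinEquiv (Q R : MvPolynomial (Fin 2) ℂ) : Prop :=
  ∃ M : Matrix (Fin 2) (Fin 2) ℂ, IsUnit M.det ∧ substMat M Q = R

/-- The Jacobian ideal `⟨∂Q/∂z1, ∂Q/∂z2⟩`. -/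
noncomputable def jacIdeal (Q : MvPolynomial (Fin 2) ℂ) : Ideal (MvPolynomial (Fin 2) ℂ) :=
  Ideal.span {pderiv 0 Q, pderiv 1 Q}

/-- The Milnor (moduli) algebra `A(Q) = ℂ[z1,z2]/⟨∂Q/∂z1, ∂Q/∂z2⟩`. -/
abbrev MilnorAlgebra (Q : MvPolynomial (Fin 2) ℂ) :=
  MvPolynomial (Fin 2) ℂ ⧸ jacIdeal Q

/-- The maximal ideal of the Milnor algebra, generated by the classes of `z1` and `z2`. -/
noncomputable def milnorMax (Q : MvPolynomial (Fin 2) ℂ) : Ideal (MilnorAlgebra Q) :=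
  Ideal.span {Ideal.Quotient.mk (jacIdeal Q) (X 0), Ideal.Quotient.mk (jacIdeal Q) (X 1)}

/-- `B` is an octavic associated to the sextic `Q`: there is a `ℂ`-linear functional `ℓ` on the
Milnor algebra of `Q`, not vanishing identically on `M^8`, such that
`B(w1,w2) = ℓ((w1 z̄1 + w2 z̄2)^8)` for all `w ∈ ℂ²`. -/
def IsAssociatedOctavic (Q B : MvPolynomial (Fin 2) ℂ) : Prop :=
  ∃ ℓ : MilnorAlgebra Q →ₗ[ℂ] ℂ,
    (∃ x ∈ (milnorMax Q) ^ 8, ℓ x ≠ 0) ∧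
    ∀ w : Fin 2 → ℂ,
      eval w B = ℓ ((w 0 • Ideal.Quotient.mk (jacIdeal Q) (X 0)
        + w 1 • Ideal.Quotient.mk (jacIdeal Q) (X 1)) ^ 8)


abbrev MP := MvPolynomial (Fin 2) ℂ

lemma td_pderiv_lt (p : MP) (i : Fin 2) (h : pderiv i p ≠ 0) :
    (pderiv i p).totalDegree < p.totalDegree := by
  obtain ⟨m, hm, hd⟩ := Finset.exists_mem_eq_sup (pderiv i p).support
    (MvPolynomial.support_nonempty.mpr h) (fun s => s.sum fun _ e => e)
  have h1 : (pderiv i p).totalDegree = m.degree := by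
    rw [MvPolynomial.totalDegree, hd]; rfl
  rw [mem_support_iff, coeff_pderiv] at hm
  have h2 : m + Finsupp.single i 1 ∈ p.support := by
    rw [mem_support_iff]
    intro h0
    apply hm
    simp [h0]
  have h3 := MvPolynomial.le_totalDegree h2
  have h4 : ((m + Finsupp.single i 1).sum fun _ e => e) = m.degree + 1 := by
    change (m + Finsupp.single i 1).degree = _
    simp
  omega

lemma td_zero_of_pderiv (p : MP) (h : ∀ i, pderiv i p = 0) : p.totalDegree = 0 := by
  rw [totalDegree_eq_zero_iff]
  intro m hm i
  by_contra hi
  have h1 : coeff (m - Finsupp.single i 1) (pderiv i p) = 0 := by rw [h i]; simp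
  have h2 : m - Finsupp.single i 1 + Finsupp.single i 1 = m := by
    apply tsub_add_cancel_of_le
    rw [Finsupp.single_le_iff]; omega
  rw [coeff_pderiv, h2] at h1
  rw [mem_support_iff] at hm
  rcases mul_eq_zero.mp h1 with h3 | h3
  · exact hm h3
  · have : ((((m - Finsupp.single i 1 : Fin 2 →₀ ℕ)) i + 1 : ℕ) : ℂ) = 0 := by push_cast; exact h3
    exact absurd (Nat.cast_eq_zero.mp this) (by omega)

lemma euler6 (Q : MP) (hQ : Q.IsHomogeneous 6) :
    X 0 * pderiv 0 Q + X 1 * pderiv 1 Q = 6 * Q := by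
  have := hQ.sum_X_mul_pderiv
  simpa using this

lemma relPrime_pderiv (Q : MP) (hQ : Q.IsHomogeneous 6) (hne : Q ≠ 0) (hsf : Squarefree Q) :
    IsRelPrime (pderiv 0 Q) (pderiv 1 Q) := by
  have h6 : (6 : MP) = C 6 := (map_ofNat C 6).symm
  have hu : IsUnit (6 : MP) := by
    rw [h6]; exact (isUnit_iff_ne_zero.mpr (by norm_num)).map C
  have he := euler6 Q hQ
  apply WfDvdMonoid.isRelPrime_of_no_irreducible_factors
  · rintro ⟨h0, h1⟩
    rw [h0, h1] at he
    simp at he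
    exact hne he
  · intro π hπ h0 h1
    have hp : Prime π := hπ.prime
    have hd : π ∣ Q := by
      have : π ∣ 6 * Q := by rw [← he]; exact dvd_add (h0.mul_left _) (h1.mul_left _)
      exact (hu.dvd_mul_left).mp this
    obtain ⟨s, rfl⟩ := hd
    have hns : ¬ π ∣ s := by
      rintro ⟨t, rfl⟩
      exact hπ.not_isUnit (hsf π ⟨t, by ring⟩)
    have key : ∀ i, pderiv i (π * s) = π * pderiv i s + s * pderiv i π := by
      intro i; rw [pderiv_mul]; ring
    have hall : ∀ i, π ∣ pderiv i (π * s) := by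
      intro i; fin_cases i
      · exact h0
      · exact h1
    have hz : ∀ i, pderiv i π = 0 := by
      intro i
      by_contra hc
      have h2 := hall i
      rw [key, dvd_add_right (dvd_mul_right _ _)] at h2
      rcases hp.dvd_or_dvd h2 with h3 | h3
      · exact hns h3
      · obtain ⟨k, hk⟩ := h3
        have hk0 : k ≠ 0 := by rintro rfl; apply hc; simpa using hk
        have := td_pderiv_lt π i hc
        rw [hk, totalDegree_mul_of_isDomain hp.ne_zero hk0] at this
        omega
    apply hπ.not_isUnit
    rw [isUnit_iff_totalDegree_of_isReduced]
    have ht := td_zero_of_pderiv π hz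
    refine ⟨?_, ht⟩
    rw [isUnit_iff_ne_zero]
    intro hc
    rw [totalDegree_eq_zero_iff_eq_C] at ht
    rw [ht, hc] at hp
    exact hp.ne_zero (by simp)

lemma syz (f g a b : MP) (hf : f.IsHomogeneous 5) (hg : g.IsHomogeneous 5) (hr : IsRelPrime f g)
    (ha : a.totalDegree ≤ 4) (hb : b.totalDegree ≤ 4) (h : f * a + g * b = 0) :
    a = 0 ∧ b = 0 := by
  have aux : ∀ f g a b : MP, f.IsHomogeneous 5 → IsRelPrime f g → b.totalDegree ≤ 4 →
      f * a + g * b = 0 → b = 0 := by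
    intro f g a b hf hr hb h
    have hd : f ∣ g * b := ⟨-a, by linear_combination h⟩
    obtain ⟨k, rfl⟩ := hr.dvd_of_dvd_mul_left hd
    by_contra hc
    obtain ⟨h1, h2⟩ := mul_ne_zero_iff.mp hc
    rw [totalDegree_mul_of_isDomain h1 h2, hf.totalDegree h1] at hb
    omega
  exact ⟨aux g f b a hg hr.symm ha (by linear_combination h), aux f g a b hf hr hb h⟩

/-- binary forms from coefficient vectors -/
noncomputable def BF (n : ℕ) : (Fin (n+1) → ℂ) →ₗ[ℂ] MP :=
  ∑ i : Fin (n+1), (LinearMap.toSpanSingleton ℂ MP (X 0 ^ (i:ℕ) * X 1 ^ (n - i))).comp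
    (LinearMap.proj i)

lemma BF_apply (n : ℕ) (c) : BF n c = ∑ i : Fin (n+1), c i • (X 0 ^ (i:ℕ) * X 1 ^ (n - i)) := by
  simp [BF]

lemma mon_eq (i j : ℕ) : (X 0 ^ i * X 1 ^ j : MP) =
    monomial (Finsupp.single 0 i + Finsupp.single 1 j) 1 := by
  rw [X_pow_eq_monomial, X_pow_eq_monomial, monomial_mul]; simp

lemma ex_eq (i j k l : ℕ) : ((Finsupp.single 0 i + Finsupp.single 1 j : Fin 2 →₀ ℕ) =
    Finsupp.single 0 k + Finsupp.single 1 l) ↔ i = k ∧ j = l := by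
  constructor
  · intro h
    have h0 := DFunLike.congr_fun h 0
    have h1 := DFunLike.congr_fun h 1
    simp at h0 h1
    exact ⟨h0, h1⟩
  · rintro ⟨rfl, rfl⟩; rfl

lemma BF_coeff (n : ℕ) (c) (i : Fin (n+1)) :
    coeff (Finsupp.single 0 (i:ℕ) + Finsupp.single 1 (n - i)) (BF n c) = c i := by
  rw [BF_apply, coeff_sum, Finset.sum_eq_single i]
  · rw [mon_eq]; simp
  · intro b _ hb
    rw [mon_eq, coeff_smul, coeff_monomial, if_neg]
    · simp
    · rw [ex_eq]; intro h; apply hb; ext; exact h.1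
  · simp

lemma BF_inj (n : ℕ) : Function.Injective (BF n) := by
  intro c d h
  ext i
  rw [← BF_coeff n c i, h, BF_coeff]

lemma BF_hom (n : ℕ) (c) : (BF n c).IsHomogeneous n := by
  rw [BF_apply]
  apply IsHomogeneous.sum
  intro i _
  rw [smul_eq_C_mul]
  apply IsHomogeneous.C_mul
  have := (isHomogeneous_X_pow (R := ℂ) (0 : Fin 2) (i:ℕ)).mul (isHomogeneous_X_pow (R := ℂ) (1 : Fin 2) (n - i))
  convert this using 1
  have := i.2; omega

lemma BF_surj (n : ℕ) (p : MP) (hp : p.IsHomogeneous n) :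
    p = BF n (fun i => coeff (Finsupp.single 0 (i:ℕ) + Finsupp.single 1 (n - i)) p) := by
  ext m
  have hm : m = Finsupp.single 0 (m 0) + Finsupp.single 1 (m 1) := by
    ext i; fin_cases i <;> simp
  have hdeg : m.degree = m 0 + m 1 := by
    rw [hm]; simp
  by_cases h : m.degree = n
  · have hlt : m 0 < n + 1 := by omega
    have h1 : m 1 = n - m 0 := by omega
    have := BF_coeff n (fun i => coeff (Finsupp.single 0 (i:ℕ) + Finsupp.single 1 (n - i)) p) ⟨m 0, hlt⟩
    simp only [← h1, ← hm] at this
    exact this.symm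
  · rw [hp.coeff_eq_zero h, (BF_hom n _).coeff_eq_zero h]

lemma BF_range (n : ℕ) : LinearMap.range (BF n) = homogeneousSubmodule (Fin 2) ℂ n := by
  ext p
  constructor
  · rintro ⟨c, rfl⟩; exact BF_hom n c
  · intro h; exact ⟨_, (BF_surj n p h).symm⟩

instance (n : ℕ) : FiniteDimensional ℂ (homogeneousSubmodule (Fin 2) ℂ n) := by
  rw [← BF_range]; infer_instance

lemma hs_finrank (n : ℕ) : Module.finrank ℂ (homogeneousSubmodule (Fin 2) ℂ n) = n + 1 := by
  rw [← BF_range, LinearMap.finrank_range_of_inj (BF_inj n)]; simp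

abbrev VV (n : ℕ) := homogeneousSubmodule (Fin 2) ℂ n

/-- the map `(a, b) ↦ f a + g b` on forms of degree `n` -/
noncomputable def LL (f g : MP) (n : ℕ) : (VV n × VV n) →ₗ[ℂ] MP :=
  LinearMap.coprod ((LinearMap.mulLeft ℂ f).comp (VV n).subtype)
    ((LinearMap.mulLeft ℂ g).comp (VV n).subtype)

lemma LL_apply (f g : MP) (n : ℕ) (x) : LL f g n x = f * (x.1 : MP) + g * (x.2 : MP) := by
  simp [LL]

lemma LL_mem (f g : MP) (n : ℕ) (p : MP) : p ∈ LinearMap.range (LL f g n) ↔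
    ∃ a b : MP, a.IsHomogeneous n ∧ b.IsHomogeneous n ∧ p = f * a + g * b := by
  constructor
  · rintro ⟨x, rfl⟩
    exact ⟨x.1, x.2, x.1.2, x.2.2, LL_apply ..⟩
  · rintro ⟨a, b, ha, hb, rfl⟩
    exact ⟨(⟨a, ha⟩, ⟨b, hb⟩), LL_apply ..⟩

lemma LL_finrank (f g : MP) (hf : f.IsHomogeneous 5) (hg : g.IsHomogeneous 5) (hr : IsRelPrime f g)
    (n : ℕ) (hn : n ≤ 4) : Module.finrank ℂ (LinearMap.range (LL f g n)) = 2 * (n + 1) := by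
  rw [LinearMap.finrank_range_of_inj, Module.finrank_prod, hs_finrank]
  · ring
  · rw [← LinearMap.ker_eq_bot, LinearMap.ker_eq_bot']
    rintro ⟨⟨a, ha⟩, ⟨b, hb⟩⟩ h
    rw [LL_apply] at h
    have ha' : a.IsHomogeneous n := ha
    have hb' : b.IsHomogeneous n := hb
    obtain ⟨h1, h2⟩ := syz f g a b hf hg hr (ha'.totalDegree_le.trans hn)
      (hb'.totalDegree_le.trans hn) h
    subst h1 h2
    rfl

lemma LL_le (f g : MP) (hf : f.IsHomogeneous 5) (hg : g.IsHomogeneous 5) (n : ℕ) :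
    LinearMap.range (LL f g n) ≤ VV (5 + n) := by
  intro p hp
  rw [LL_mem] at hp
  obtain ⟨a, b, ha, hb, rfl⟩ := hp
  exact (hf.mul ha).add (hg.mul hb)

lemma deg9 (f g : MP) (hf : f.IsHomogeneous 5) (hg : g.IsHomogeneous 5) (hr : IsRelPrime f g)
    (p : MP) (hp : p.IsHomogeneous 9) :
    ∃ a b : MP, a.IsHomogeneous 4 ∧ b.IsHomogeneous 4 ∧ p = f * a + g * b := by
  rw [← LL_mem]
  have := Submodule.eq_of_le_of_finrank_eq (LL_le f g hf hg 4) (by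
    rw [LL_finrank f g hf hg hr 4 le_rfl, hs_finrank])
  rw [this]; exact hp

lemma deg8 (f g : MP) (hf : f.IsHomogeneous 5) (hg : g.IsHomogeneous 5) (hr : IsRelPrime f g)
    (l : MP →ₗ[ℂ] ℂ) (hl : ∀ a b, l (f * a + g * b) = 0)
    (p0 : MP) (hp0 : p0.IsHomogeneous 8) (hlp0 : l p0 ≠ 0)
    (p : MP) (hp : p.IsHomogeneous 8) (hlp : l p = 0) :
    ∃ a b : MP, a.IsHomogeneous 3 ∧ b.IsHomogeneous 3 ∧ p = f * a + g * b := by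
  rw [← LL_mem]
  have h1 : LinearMap.range (LL f g 3) ≤ LinearMap.ker l ⊓ VV 8 := by
    refine le_inf ?_ (LL_le f g hf hg 3)
    intro q hq
    rw [LL_mem] at hq
    obtain ⟨a, b, -, -, rfl⟩ := hq
    exact hl a b
  have h2 : LinearMap.ker l ⊓ VV 8 < VV 8 := by
    refine lt_of_le_of_ne inf_le_right ?_
    intro h
    have : p0 ∈ LinearMap.ker l ⊓ VV 8 := by rw [h]; exact hp0
    exact hlp0 this.1
  have h3 := Submodule.finrank_lt_finrank_of_lt h2
  rw [hs_finrank] at h3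
  have : FiniteDimensional ℂ (LinearMap.ker l ⊓ VV 8 : Submodule ℂ MP) :=
    Submodule.finiteDimensional_of_le h2.le
  have := Submodule.eq_of_le_of_finrank_le h1 (by
    rw [LL_finrank f g hf hg hr 3 (by norm_num)]; omega)
  rw [this]; exact ⟨hlp, hp⟩

lemma hom_div (n : ℕ) (a a' : MP) (i : Fin 2) (h : a = X i * a') (ha : a.IsHomogeneous (n+1)) :
    a'.IsHomogeneous n := by
  intro m hm
  have h1 : coeff (m + Finsupp.single i 1) a ≠ 0 := by
    rw [h, mul_comm, coeff_mul_X]; exact hm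
  have := ha h1
  simp only [map_add] at this
  rw [Finsupp.weight_single] at this
  simp at this
  omega

lemma socle (f g : MP) (hf : f.IsHomogeneous 5) (hg : g.IsHomogeneous 5) (hr : IsRelPrime f g)
    (n : ℕ) (hn : n ≤ 2) (p : MP)
    (h0 : p * X 0 ∈ LinearMap.range (LL f g (n+1)))
    (h1 : p * X 1 ∈ LinearMap.range (LL f g (n+1))) : p ∈ LinearMap.range (LL f g n) := by
  rw [LL_mem] at *
  obtain ⟨a, b, ha, hb, hab⟩ := h0
  obtain ⟨c, d, hc, hd, hcd⟩ := h1
  have k1 := ((isHomogeneous_X ℂ (1 : Fin 2)).mul ha).sub ((isHomogeneous_X ℂ (0 : Fin 2)).mul hc)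
  have k2 := ((isHomogeneous_X ℂ (1 : Fin 2)).mul hb).sub ((isHomogeneous_X ℂ (0 : Fin 2)).mul hd)
  obtain ⟨e1, e2⟩ := syz f g _ _ hf hg hr (k1.totalDegree_le.trans (by omega))
    (k2.totalDegree_le.trans (by omega)) (by linear_combination (-X 1) * hab + X 0 * hcd)
  have hx : ∀ a c : MP, X 1 * a - X 0 * c = 0 → X 0 ∣ a := by
    intro a c h
    have : (X 0 : MP) ∣ X 1 * a := ⟨c, by linear_combination h⟩
    rcases (X_prime (R := ℂ) (i := (0 : Fin 2))).dvd_or_dvd this with h | h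
    · rw [X_dvd_X] at h
      simp at h
    · exact h
  obtain ⟨a', ha'⟩ := hx _ _ e1
  obtain ⟨b', hb'⟩ := hx _ _ e2
  refine ⟨a', b', hom_div n a a' 0 ha' ha, hom_div n b b' 0 hb' hb, ?_⟩
  apply mul_right_cancel₀ (X_ne_zero (R := ℂ) (0 : Fin 2))
  rw [hab, ha', hb']; ring

lemma keyLemma (f g : MP) (hf : f.IsHomogeneous 5) (hg : g.IsHomogeneous 5) (hr : IsRelPrime f g)
    (l : MP →ₗ[ℂ] ℂ) (hl : ∀ a b, l (f * a + g * b) = 0)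
    (p0 : MP) (hp0 : p0.IsHomogeneous 8) (hlp0 : l p0 ≠ 0)
    (p : MP) (hp : p.IsHomogeneous 5) (hlp : ∀ q : MP, q.IsHomogeneous 3 → l (p * q) = 0) :
    ∃ a b : ℂ, p = C a * f + C b * g := by
  have s3 : ∀ q : MP, q.IsHomogeneous 3 → p * q ∈ LinearMap.range (LL f g 3) := by
    intro q hq
    rw [LL_mem]
    exact deg8 f g hf hg hr l hl p0 hp0 hlp0 _ (hp.mul hq) (hlp q hq)
  have step : ∀ n ≤ 2, (∀ q : MP, q.IsHomogeneous (n+1) → p * q ∈ LinearMap.range (LL f g (n+1))) →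
      ∀ q : MP, q.IsHomogeneous n → p * q ∈ LinearMap.range (LL f g n) := by
    intro n hn h q hq
    apply socle f g hf hg hr n hn
    · rw [mul_assoc]; exact h _ (hq.mul (isHomogeneous_X ℂ _))
    · rw [mul_assoc]; exact h _ (hq.mul (isHomogeneous_X ℂ _))
  have := step 0 (by norm_num) (step 1 (by norm_num) (step 2 le_rfl s3)) 1 (isHomogeneous_one _ _)
  rw [LL_mem] at this
  obtain ⟨a, b, ha, hb, h⟩ := this
  have hc : ∀ a : MP, a.IsHomogeneous 0 → a = C (coeff 0 a) := by
    intro a ha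
    exact totalDegree_eq_zero_iff_eq_C.mp ((totalDegree_zero_iff_isHomogeneous _).mpr ha)
  refine ⟨coeff 0 a, coeff 0 b, ?_⟩
  rw [← hc a ha, ← hc b hb]
  linear_combination h

lemma hom_split (n : ℕ) (p : MP) (hp : p.IsHomogeneous (n+1)) :
    ∃ a b : MP, a.IsHomogeneous n ∧ b.IsHomogeneous n ∧ p = X 0 * a + X 1 * b := by
  have h := hp.sum_X_mul_pderiv
  refine ⟨C ((n+1 : ℂ)⁻¹) * pderiv 0 p, C ((n+1 : ℂ)⁻¹) * pderiv 1 p, ?_, ?_, ?_⟩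
  · exact (hp.pderiv).C_mul _
  · exact (hp.pderiv).C_mul _
  · rw [Fin.sum_univ_two, nsmul_eq_mul] at h
    have h2 : (C ((n+1 : ℂ)⁻¹) : MP) * ((n+1 : ℕ) : MP) = 1 := by
      rw [← map_natCast (C : ℂ →+* MP), ← C_mul]
      have : (n : ℂ) + 1 ≠ 0 := by exact_mod_cast Nat.succ_ne_zero n
      push_cast
      rw [inv_mul_cancel₀ this, C_1]
    linear_combination (-C ((n+1 : ℂ)⁻¹)) * h - p * h2

lemma deg_ge9 (f g : MP) (hf : f.IsHomogeneous 5) (hg : g.IsHomogeneous 5) (hr : IsRelPrime f g)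
    (n : ℕ) : ∀ (p : MP), p.IsHomogeneous (9 + n) → ∃ a b : MP, p = f * a + g * b := by
  induction n with
  | zero =>
    intro p hp
    obtain ⟨a, b, -, -, h⟩ := deg9 f g hf hg hr p hp
    exact ⟨a, b, h⟩
  | succ n ih =>
    intro p hp
    obtain ⟨a, b, ha, hb, rfl⟩ := hom_split (9 + n) p hp
    obtain ⟨a1, a2, rfl⟩ := ih a ha
    obtain ⟨b1, b2, rfl⟩ := ih b hb
    exact ⟨X 0 * a1 + X 1 * b1, X 0 * a2 + X 1 * b2, by ring⟩

lemma octavic_data (Q B : MP) (hQ : Q.IsHomogeneous 6) (hne : Q ≠ 0) (hsf : Squarefree Q)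
    (hB : IsAssociatedOctavic Q B) :
    ∃ l : MP →ₗ[ℂ] ℂ, (∀ a b, l (pderiv 0 Q * a + pderiv 1 Q * b) = 0) ∧
      (∃ p0 : MP, p0.IsHomogeneous 8 ∧ l p0 ≠ 0) ∧
      ∀ w : Fin 2 → ℂ, eval w B = l ((C (w 0) * X 0 + C (w 1) * X 1) ^ 8) := by
  obtain ⟨ℓ, ⟨x, hx, hlx⟩, hw⟩ := hB
  have hr := relPrime_pderiv Q hQ hne hsf
  have hf : (pderiv 0 Q).IsHomogeneous 5 := hQ.pderiv
  have hg : (pderiv 1 Q).IsHomogeneous 5 := hQ.pderiv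
  let l : MP →ₗ[ℂ] ℂ := ℓ.comp (Ideal.Quotient.mkₐ ℂ (jacIdeal Q)).toLinearMap
  have hl : ∀ p, l p = ℓ (Ideal.Quotient.mk (jacIdeal Q) p) := fun p => rfl
  have hl0 : ∀ a b, l (pderiv 0 Q * a + pderiv 1 Q * b) = 0 := by
    intro a b
    rw [hl, Ideal.Quotient.eq_zero_iff_mem.mpr, map_zero]
    apply Ideal.add_mem
    · exact Ideal.mul_mem_right _ _ (Ideal.subset_span (by simp))
    · exact Ideal.mul_mem_right _ _ (Ideal.subset_span (by simp))
  refine ⟨l, hl0, ?_, ?_⟩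
  · by_contra hcon
    push Not at hcon
    have hall : ∀ n, ∀ p : MP, p.IsHomogeneous (8 + n) → l p = 0 := by
      intro n p hp
      cases n with
      | zero => exact hcon p hp
      | succ n =>
        obtain ⟨a, b, rfl⟩ := deg_ge9 _ _ hf hg hr n p (by convert hp using 1; ring)
        exact hl0 a b
    apply hlx
    have hmax : milnorMax Q = (Ideal.span {X 0, X 1} : Ideal MP).map
        (Ideal.Quotient.mk (jacIdeal Q)) := by
      rw [milnorMax, Ideal.map_span, Set.image_pair]
    rw [hmax, ← Ideal.map_pow, Ideal.mem_map_iff_of_surjective _ Ideal.Quotient.mk_surjective] at hx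
    obtain ⟨p, hp, rfl⟩ := hx
    rw [← hl]
    have hset : ({X 0, X 1} : Set MP) = Set.range (X : Fin 2 → MP) := by
      ext y; simp [Fin.exists_fin_two, eq_comm]
    rw [hset, mem_pow_idealOfVars_iff] at hp
    rw [← support_sum_monomial_coeff p, map_sum]
    apply Finset.sum_eq_zero
    intro m hm
    obtain ⟨n, hn⟩ := Nat.exists_eq_add_of_le (hp m hm)
    exact hall n _ (isHomogeneous_monomial _ hn)
  · intro w
    have hsm : ∀ (a : ℂ) (p : MP), a • Ideal.Quotient.mk (jacIdeal Q) p =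
        Ideal.Quotient.mk (jacIdeal Q) (C a * p) := by
      intro a p
      rw [← smul_eq_C_mul]; rfl
    rw [hw, hl, hsm, hsm, ← map_add, ← map_pow]

noncomputable def sM (M : Matrix (Fin 2) (Fin 2) ℂ) : MP →ₐ[ℂ] MP :=
  aeval (fun i => MvPolynomial.C (M i 0) * X 0 + MvPolynomial.C (M i 1) * X 1)

lemma substMat_eq (M) (Q : MP) : substMat M Q = sM M Q := rfl

lemma sM_X (M) (i : Fin 2) : sM M (X i) = C (M i 0) * X 0 + C (M i 1) * X 1 := by
  simp [sM]

lemma sM_C (M) (a : ℂ) : sM M (C a) = C a := by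
  simp [sM]

lemma sM_comp (A B : Matrix (Fin 2) (Fin 2) ℂ) (Q : MP) : sM A (sM B Q) = sM (B * A) Q := by
  have : (sM A).comp (sM B) = sM (B * A) := by
    apply MvPolynomial.algHom_ext
    intro i
    rw [AlgHom.comp_apply, sM_X, sM_X, map_add, map_mul, map_mul, sM_X, sM_X, sM_C, sM_C]
    simp only [Matrix.mul_apply, Fin.sum_univ_two, map_add, map_mul]
    ring
  rw [← this]; rfl

lemma sM_one (Q : MP) : sM 1 Q = Q := by
  have : sM 1 = AlgHom.id ℂ MP := by
    apply MvPolynomial.algHom_ext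
    intro i
    rw [sM_X]
    fin_cases i <;> simp [Matrix.one_apply]
  rw [this]; rfl

lemma sM_hom (M) (Q : MP) (n : ℕ) (hQ : Q.IsHomogeneous n) : (sM M Q).IsHomogeneous n := by
  have := hQ.aeval (fun i => MvPolynomial.C (M i 0) * X 0 + MvPolynomial.C (M i 1) * X 1 : Fin 2 → MP) (n := 1)
    (fun i => ((isHomogeneous_C_mul_X _ _).add (isHomogeneous_C_mul_X _ _)))
  simpa [sM] using this

lemma sM_inv_left (M : Matrix (Fin 2) (Fin 2) ℂ) (hM : IsUnit M.det) (Q : MP) :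
    sM M⁻¹ (sM M Q) = Q := by
  rw [sM_comp, Matrix.mul_nonsing_inv _ hM, sM_one]

lemma sM_inv_right (M : Matrix (Fin 2) (Fin 2) ℂ) (hM : IsUnit M.det) (Q : MP) :
    sM M (sM M⁻¹ Q) = Q := by
  rw [sM_comp, Matrix.nonsing_inv_mul _ hM, sM_one]

lemma sM_sf (M : Matrix (Fin 2) (Fin 2) ℂ) (hM : IsUnit M.det) (Q : MP) (h : Squarefree Q) :
    Squarefree (sM M Q) := by
  intro p hp
  have h1 := map_dvd (sM M⁻¹) hp
  rw [sM_inv_left M hM, map_mul] at h1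
  have h2 := (h _ h1).map (sM M)
  rwa [sM_inv_right M hM] at h2

lemma LinEquiv.comp {P Q R : MP} (h1 : LinEquiv P Q) (h2 : LinEquiv Q R) : LinEquiv P R := by
  obtain ⟨A, hA, rfl⟩ := h1
  obtain ⟨B, hB, rfl⟩ := h2
  refine ⟨A * B, by rw [Matrix.det_mul]; exact hA.mul hB, ?_⟩
  simp only [substMat_eq, sM_comp]

lemma LinEquiv.flip {P Q : MP} (h1 : LinEquiv P Q) : LinEquiv Q P := by
  obtain ⟨A, hA, rfl⟩ := h1
  refine ⟨A⁻¹, Matrix.isUnit_nonsing_inv_det _ hA, ?_⟩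
  simp only [substMat_eq, sM_inv_left A hA]

lemma pderiv_sM (M : Matrix (Fin 2) (Fin 2) ℂ) (Q : MP) (i : Fin 2) :
    pderiv i (sM M Q) = C (M 0 i) * sM M (pderiv 0 Q) + C (M 1 i) * sM M (pderiv 1 Q) := by
  induction Q using MvPolynomial.induction_on with
  | C a => simp
  | add p q hp hq => simp only [map_add, hp, hq]; ring
  | mul_X p j hp =>
    simp only [map_mul, pderiv_mul, hp, sM_X, map_add]
    fin_cases i <;> fin_cases j <;> simp [pderiv_X] <;> ring

lemma powers_span (l : MP →ₗ[ℂ] ℂ)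
    (h : ∀ w : Fin 2 → ℂ, l ((C (w 0) * X 0 + C (w 1) * X 1) ^ 8) = 0)
    (p : MP) (hp : p.IsHomogeneous 8) : l p = 0 := by
  let P : Polynomial ℂ := ∑ i ∈ Finset.range 9,
    Polynomial.C (l (X 0 ^ i * X 1 ^ (8 - i)) * (Nat.choose 8 i : ℂ)) * Polynomial.X ^ i
  have hP : P = 0 := by
    apply Polynomial.funext
    intro t
    have := h ![t, 1]
    rw [add_pow, map_sum] at this
    simp only [P, Polynomial.eval_finsetSum, Polynomial.eval_zero]
    rw [← this]
    apply Finset.sum_congr rfl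
    intro i _
    have : ((C t * X 0) ^ i * (C 1 * X 1) ^ (8 - i) * ((Nat.choose 8 i : ℕ) : MP) : MP)
      = (t ^ i * (Nat.choose 8 i : ℂ)) • (X 0 ^ i * X 1 ^ (8 - i)) := by
      rw [smul_eq_C_mul, ← map_natCast (C : ℂ →+* MP)]
      simp only [map_mul, map_pow, map_one]
      ring
    simp only [Matrix.cons_val_zero, Matrix.cons_val_one] at *
    rw [this, map_smul]
    simp
    ring
  have hc : ∀ i < 9, l (X 0 ^ i * X 1 ^ (8 - i)) = 0 := by
    intro i hi
    have h1 : P.coeff i = 0 := by rw [hP]; simp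
    simp only [P, Polynomial.finsetSum_coeff, Polynomial.coeff_C_mul_X_pow] at h1
    rw [Finset.sum_eq_single i] at h1
    · simp only [if_true] at h1
      rcases mul_eq_zero.mp h1 with h2 | h2
      · exact h2
      · exact absurd (Nat.cast_eq_zero.mp h2) (Nat.choose_pos (by omega)).ne'
    · intro j _ hj; rw [if_neg (Ne.symm hj)]
    · intro hj; exact absurd (Finset.mem_range.mpr hi) hj
  rw [BF_surj 8 p hp, BF_apply, map_sum]
  apply Finset.sum_eq_zero
  intro i _
  rw [map_smul, hc i i.2, smul_zero]

lemma normal_form (N : Matrix (Fin 2) (Fin 2) ℂ) :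
    ∃ (P : Matrix (Fin 2) (Fin 2) ℂ) (a e d : ℂ), P.det ≠ 0 ∧ P * N = !![a, 0; e, d] * P ∧
      (e = 0 ∨ a = d) := by
  obtain ⟨s, hs⟩ := IsAlgClosed.exists_pow_nat_eq
    ((N 0 0 + N 1 1) ^ 2 - 4 * (N 0 0 * N 1 1 - N 0 1 * N 1 0)) (n := 2) (by norm_num)
  obtain ⟨a, ha⟩ : ∃ a : ℂ, (N 0 0 - a) * (N 1 1 - a) - N 0 1 * N 1 0 = 0 :=
    ⟨(N 0 0 + N 1 1 + s) / 2, by linear_combination hs / 4⟩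
  obtain ⟨v0, v1, hv, e0, e1⟩ : ∃ v0 v1 : ℂ, (v0 ≠ 0 ∨ v1 ≠ 0) ∧
      v0 * N 0 0 + v1 * N 1 0 = a * v0 ∧ v0 * N 0 1 + v1 * N 1 1 = a * v1 := by
    obtain ⟨v, hv, h⟩ := (Matrix.exists_vecMul_eq_zero_iff
      (M := !![N 0 0 - a, N 0 1; N 1 0, N 1 1 - a])).mpr (by
        rw [Matrix.det_fin_two_of]; exact ha)
    refine ⟨v 0, v 1, ?_, ?_, ?_⟩
    · by_contra hc
      push Not at hc
      apply hv
      ext i; fin_cases i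
      · exact hc.1
      · exact hc.2
    · have := congrFun h 0
      simp [Matrix.vecMul, dotProduct, Fin.sum_univ_two] at this
      linear_combination this
    · have := congrFun h 1
      simp [Matrix.vecMul, dotProduct, Fin.sum_univ_two] at this
      linear_combination this
  obtain ⟨u0, u1, e, d, hdet, f0, f1⟩ : ∃ u0 u1 e d : ℂ, v0 * u1 - v1 * u0 ≠ 0 ∧
      u0 * N 0 0 + u1 * N 1 0 = e * v0 + d * u0 ∧ u0 * N 0 1 + u1 * N 1 1 = e * v1 + d * u1 := by
    by_cases h0 : v0 = 0
    · subst h0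
      have h1 : v1 ≠ 0 := by simpa using hv
      refine ⟨1, 0, N 0 1 / v1, N 0 0, by simpa using h1, by ring, by field_simp; ring⟩
    · refine ⟨0, 1, N 1 0 / v0, N 1 1 - N 1 0 / v0 * v1, by simpa using h0, by field_simp; ring,
        by ring⟩
  have main : ∀ u0 u1 e : ℂ, v0 * u1 - v1 * u0 ≠ 0 →
      u0 * N 0 0 + u1 * N 1 0 = e * v0 + d * u0 → u0 * N 0 1 + u1 * N 1 1 = e * v1 + d * u1 →
      (!![v0, v1; u0, u1] : Matrix (Fin 2) (Fin 2) ℂ).det ≠ 0 ∧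
      !![v0, v1; u0, u1] * N = !![a, 0; e, d] * !![v0, v1; u0, u1] := by
    intro u0 u1 e hdet f0 f1
    refine ⟨by rwa [Matrix.det_fin_two_of], ?_⟩
    ext i j
    fin_cases i <;> fin_cases j <;> simp [Matrix.mul_apply, Fin.sum_univ_two] <;> assumption
  by_cases had : a = d
  · exact ⟨_, a, e, d, (main u0 u1 e hdet f0 f1).1, (main u0 u1 e hdet f0 f1).2, Or.inr had⟩
  · have hda : d - a ≠ 0 := fun h => had (sub_eq_zero.mp h).symm
    obtain ⟨k, hk⟩ : ∃ k : ℂ, k * (d - a) = e := ⟨e / (d - a), by field_simp⟩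
    have := main (u0 + k * v0) (u1 + k * v1) 0 (by
        convert hdet using 1; ring) (by linear_combination f0 + k * e0 - v0 * hk)
        (by linear_combination f1 + k * e1 - v1 * hk)
    exact ⟨_, a, 0, d, this.1, this.2, Or.inl rfl⟩

/-- coefficient of a monomial -/
noncomputable def cf (Q : MP) (i j : ℕ) : ℂ := coeff (Finsupp.single 0 i + Finsupp.single 1 j) Q

lemma cf_C_mul (Q : MP) (a : ℂ) (i j : ℕ) : cf (C a * Q) i j = a * cf Q i j := by
  simp [cf]

lemma cf_add (P Q : MP) (i j : ℕ) : cf (P + Q) i j = cf P i j + cf Q i j := by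
  simp [cf]

lemma cf_pderiv0 (Q : MP) (i j : ℕ) : cf (pderiv 0 Q) i j = cf Q (i+1) j * (i + 1) := by
  rw [cf, coeff_pderiv, cf]
  have : (Finsupp.single 0 i + Finsupp.single 1 j + Finsupp.single 0 1 : Fin 2 →₀ ℕ) =
    Finsupp.single 0 (i+1) + Finsupp.single 1 j := by rw [Finsupp.single_add]; abel
  rw [this]; simp

lemma cf_pderiv1 (Q : MP) (i j : ℕ) : cf (pderiv 1 Q) i j = cf Q i (j+1) * (j + 1) := by
  rw [cf, coeff_pderiv, cf]
  have : (Finsupp.single 0 i + Finsupp.single 1 j + Finsupp.single 1 1 : Fin 2 →₀ ℕ) =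
    Finsupp.single 0 i + Finsupp.single 1 (j+1) := by rw [Finsupp.single_add]; abel
  rw [this]; simp

lemma form6 (Q : MP) (hQ : Q.IsHomogeneous 6) : Q = C (cf Q 0 6) * X 1 ^ 6
    + C (cf Q 1 5) * (X 0 * X 1 ^ 5) + C (cf Q 2 4) * (X 0 ^ 2 * X 1 ^ 4)
    + C (cf Q 3 3) * (X 0 ^ 3 * X 1 ^ 3) + C (cf Q 4 2) * (X 0 ^ 4 * X 1 ^ 2)
    + C (cf Q 5 1) * (X 0 ^ 5 * X 1) + C (cf Q 6 0) * X 0 ^ 6 := by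
  conv_lhs => rw [BF_surj 6 Q hQ, BF_apply, Fin.sum_univ_seven]
  change cf Q 0 6 • (X 0 ^ 0 * X 1 ^ 6) + cf Q 1 5 • (X 0 ^ 1 * X 1 ^ 5)
    + cf Q 2 4 • (X 0 ^ 2 * X 1 ^ 4) + cf Q 3 3 • (X 0 ^ 3 * X 1 ^ 3)
    + cf Q 4 2 • (X 0 ^ 4 * X 1 ^ 2) + cf Q 5 1 • (X 0 ^ 5 * X 1 ^ 1)
    + cf Q 6 0 • (X 0 ^ 6 * X 1 ^ 0) = _
  simp only [smul_eq_C_mul]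
  ring

lemma not_sf (Q k : MP) (i : Fin 2) (h : Q = X i * X i * k) (hs : Squarefree Q) : False := by
  have := hs (X i) ⟨k, h⟩
  exact (X_prime (R := ℂ) (i := i)).not_isUnit this

lemma diag_equiv (Q R : MP) (a d : ℂ) (ha : a ≠ 0) (hd : d ≠ 0)
    (h : ∀ s t : ℂ, s ^ 6 = a → t ^ 6 = d → sM !![s, 0; 0, t] Q = R) : LinEquiv Q R := by
  obtain ⟨s, hs⟩ := IsAlgClosed.exists_pow_nat_eq a (n := 6) (by norm_num)
  obtain ⟨t, ht⟩ := IsAlgClosed.exists_pow_nat_eq d (n := 6) (by norm_num)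
  refine ⟨!![s, 0; 0, t], ?_, h s t hs ht⟩
  rw [Matrix.det_fin_two_of, isUnit_iff_ne_zero]
  have : s ≠ 0 := by rintro rfl; apply ha; rw [← hs]; norm_num
  have : t ≠ 0 := by rintro rfl; apply hd; rw [← ht]; norm_num
  simp [*]

lemma final_normal (Q R : MP) (hQ : Q.IsHomogeneous 6) (hR : R.IsHomogeneous 6)
    (hQs : Squarefree Q) (hRs : Squarefree R) (a e d : ℂ) (hed : e = 0 ∨ a = d)
    (h0 : pderiv 0 R = C a * pderiv 0 Q)
    (h1 : pderiv 1 R = C e * pderiv 0 Q + C d * pderiv 1 Q) : LinEquiv Q R := by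
  have hR0 : R ≠ 0 := hRs.ne_zero
  have c0 : ∀ i j, cf R (i+1) j = a * cf Q (i+1) j := by
    intro i j
    have := congrArg (fun p => cf p i j) h0
    simp only [cf_pderiv0, cf_C_mul] at this
    have hi : (i : ℂ) + 1 ≠ 0 := by exact_mod_cast Nat.succ_ne_zero i
    apply mul_right_cancel₀ hi
    linear_combination this
  have c1 : ∀ i j : ℕ, cf R i (j+1) * (j+1) = e * (cf Q (i+1) j * (i + 1)) + d * (cf Q i (j+1) * (j+1)) := by
    intro i j
    have := congrArg (fun p => cf p i j) h1
    simp only [cf_pderiv0, cf_pderiv1, cf_C_mul, cf_add] at this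
    exact this
  have fQ := form6 Q hQ
  have fR := form6 R hR
  have a1 := c0 0 5
  have a2 := c0 1 4
  have a3 := c0 2 3
  have a4 := c0 3 2
  have a5 := c0 4 1
  have a6 := c0 5 0
  have b1 := c1 0 5
  have b2 := c1 1 4
  have b3 := c1 2 3
  have b4 := c1 3 2
  have b5 := c1 4 1
  have b6 := c1 5 0
  norm_num at a1 a2 a3 a4 a5 a6 b1 b2 b3 b4 b5 b6
  by_cases he : e = 0
  · subst he
    have b1' : cf R 0 6 = d * cf Q 0 6 := by linear_combination b1 / 6
    by_cases had : a = d
    · subst had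
      have hRQ : R = C a * Q := by
        rw [fR, a1, a2, a3, a4, a5, a6, b1']
        conv_rhs => rw [fQ]
        simp only [map_mul]; ring
      have ha : a ≠ 0 := by rintro rfl; apply hR0; rw [hRQ]; simp
      obtain ⟨s, hs⟩ := IsAlgClosed.exists_pow_nat_eq a (n := 6) (by norm_num)
      have hs0 : s ≠ 0 := by rintro rfl; apply ha; rw [← hs]; norm_num
      refine ⟨!![s, 0; 0, s], ?_, ?_⟩
      · rw [Matrix.det_fin_two_of, isUnit_iff_ne_zero]; simp [hs0]
      · rw [hRQ, ← hs, substMat_eq, fQ]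
        simp only [map_add, map_mul, map_pow, sM_X, sM_C]
        simp
        ring
    · have hz : ∀ x y z : ℂ, x = a * y → x = d * y → y = 0 := by
        intro x y z h h'
        have : (a - d) * y = 0 := by linear_combination h' - h
        exact (mul_eq_zero.mp this).resolve_left (sub_ne_zero.mpr had)
      have z1 := hz _ _ 0 a1 (by linear_combination b2 / 5)
      have z2 := hz _ _ 0 a2 (by linear_combination b3 / 4)
      have z3 := hz _ _ 0 a3 (by linear_combination b4 / 3)
      have z4 := hz _ _ 0 a4 (by linear_combination b5 / 2)
      have z5 := hz _ _ 0 a5 (by linear_combination b6)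
      rw [z1, z2, z3, z4, z5] at fQ
      rw [a1, a2, a3, a4, a5, a6, b1', z1, z2, z3, z4, z5] at fR
      simp only [mul_zero, map_zero, zero_mul, add_zero, map_mul] at fQ fR
      have ha : a ≠ 0 := by
        rintro rfl
        exact not_sf R (C d * C (cf Q 0 6) * X 1 ^ 4) 1 (by rw [fR, map_zero]; ring) hRs
      have hd : d ≠ 0 := by
        rintro rfl
        exact not_sf R (C a * C (cf Q 6 0) * X 0 ^ 4) 0 (by rw [fR, map_zero]; ring) hRs
      apply diag_equiv Q R a d ha hd
      intro s t hs ht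
      generalize cf Q 0 6 = x at fQ fR
      generalize cf Q 6 0 = y at fQ fR
      rw [fR, fQ, ← hs, ← ht]
      simp only [map_add, map_mul, map_pow, sM_X, sM_C]
      simp
      ring
  · have had := hed.resolve_left he
    subst had
    exfalso
    have hz : ∀ y : ℂ, e * y = 0 → y = 0 := fun y h => (mul_eq_zero.mp h).resolve_left he
    have z2 := hz (cf Q 2 4) (by linear_combination 5/2 * a1 - b2 / 2)
    have z3 := hz (cf Q 3 3) (by linear_combination 4/3 * a2 - b3 / 3)
    have z4 := hz (cf Q 4 2) (by linear_combination 3/4 * a3 - b4 / 4)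
    have z5 := hz (cf Q 5 1) (by linear_combination 2/5 * a4 - b5 / 5)
    have z6 := hz (cf Q 6 0) (by linear_combination 1/6 * a5 - b6 / 6)
    rw [z2, z3, z4, z5, z6] at fQ
    simp only [map_zero, zero_mul, add_zero] at fQ
    exact not_sf Q (C (cf Q 0 6) * X 1 ^ 4 + C (cf Q 1 5) * (X 0 * X 1 ^ 3)) 1
      (by conv_lhs => rw [fQ]
          ring) hQs

lemma final_step (Q R : MP) (hQ : Q.IsHomogeneous 6) (hR : R.IsHomogeneous 6)
    (hQs : Squarefree Q) (hRs : Squarefree R) (N : Matrix (Fin 2) (Fin 2) ℂ)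
    (h : ∀ i, pderiv i R = C (N i 0) * pderiv 0 Q + C (N i 1) * pderiv 1 Q) : LinEquiv Q R := by
  obtain ⟨P, a, e, d, hP, hPN, hed⟩ := normal_form N
  have hdet : IsUnit (P.transpose).det := by rw [Matrix.det_transpose]; exact hP.isUnit
  have E : ∀ i j, (P * N) i j = (!![a, 0; e, d] * P) i j := fun i j => by rw [hPN]
  simp only [Matrix.mul_apply, Fin.sum_univ_two] at E
  have E00 := congrArg (C : ℂ → MP) (E 0 0)
  have E01 := congrArg (C : ℂ → MP) (E 0 1)
  have E10 := congrArg (C : ℂ → MP) (E 1 0)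
  have E11 := congrArg (C : ℂ → MP) (E 1 1)
  simp at E00 E01 E10 E11
  have key : LinEquiv (sM P.transpose Q) (sM P.transpose R) := by
    apply final_normal _ _ (sM_hom _ _ _ hQ) (sM_hom _ _ _ hR) (sM_sf _ hdet _ hQs)
      (sM_sf _ hdet _ hRs) a e d hed
    · rw [pderiv_sM, pderiv_sM, h 0, h 1]
      simp only [map_add, map_mul, sM_C, Matrix.transpose_apply]
      linear_combination sM P.transpose (pderiv 0 Q) * E00 + sM P.transpose (pderiv 1 Q) * E01
    · rw [pderiv_sM, pderiv_sM, pderiv_sM, h 0, h 1]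
      simp only [map_add, map_mul, sM_C, Matrix.transpose_apply]
      linear_combination sM P.transpose (pderiv 0 Q) * E10 + sM P.transpose (pderiv 1 Q) * E11
  have q1 : LinEquiv Q (sM P.transpose Q) := ⟨_, hdet, rfl⟩
  have q2 : LinEquiv R (sM P.transpose R) := ⟨_, hdet, rfl⟩
  exact (q1.comp key).comp q2.flip

/-- Let `Q1, Q2` be nonzero square-free binary sextics with associated
octavics `𝐐1, 𝐐2`. If `𝐐1` and `𝐐2` are linearly equivalent up to scale, then `Q1` and `Q2`
are linearly equivalent. -/
theorem sextics_equivalent_of_associated_octavics (Q1 Q2 B1 B2 : MvPolynomial (Fin 2) ℂ)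
    (h1hom : Q1.IsHomogeneous 6) (h2hom : Q2.IsHomogeneous 6)
    (h1ne : Q1 ≠ 0) (h2ne : Q2 ≠ 0) (h1sf : Squarefree Q1) (h2sf : Squarefree Q2)
    (hB1 : IsAssociatedOctavic Q1 B1) (hB2 : IsAssociatedOctavic Q2 B2)
    (hequiv : ∃ (c : ℂ) (M : Matrix (Fin 2) (Fin 2) ℂ),
      c ≠ 0 ∧ IsUnit M.det ∧ MvPolynomial.C c * substMat M B1 = B2) :
    LinEquiv Q1 Q2 := by

  obtain ⟨c, M, hc, hM, hcM⟩ := hequiv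
  obtain ⟨l1, k1, ⟨p0, hp0, hlp0⟩, w1⟩ := octavic_data Q1 B1 h1hom h1ne h1sf hB1
  obtain ⟨l2, k2, -, w2⟩ := octavic_data Q2 B2 h2hom h2ne h2sf hB2
  have hr := relPrime_pderiv Q1 h1hom h1ne h1sf
  have hf : (pderiv 0 Q1).IsHomogeneous 5 := h1hom.pderiv
  have hg : (pderiv 1 Q1).IsHomogeneous 5 := h1hom.pderiv
  have hT : IsUnit (M.transpose).det := by rwa [Matrix.det_transpose]
  have hw : ∀ p : MP, p.IsHomogeneous 8 → l2 p = c * l1 (sM M.transpose p) := by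
    intro p hp
    have := powers_span (l2 - c • l1.comp (sM M.transpose).toLinearMap) (by
      intro w
      have e2 := w2 w
      rw [← hcM, map_mul, eval_C] at e2
      have ev : eval w (substMat M B1) =
          eval (fun i => M i 0 * w 0 + M i 1 * w 1) B1 := by
        have hh : ((aeval w : MP →ₐ[ℂ] ℂ).comp (sM M)) =
            aeval (fun i => M i 0 * w 0 + M i 1 * w 1) := by
          apply MvPolynomial.algHom_ext
          intro i
          rw [AlgHom.comp_apply, sM_X]
          simp
        have := DFunLike.congr_fun hh B1
        simpa [substMat_eq, aeval_eq_eval] using this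
      rw [ev, w1] at e2
      simp only [LinearMap.sub_apply, LinearMap.smul_apply, LinearMap.comp_apply,
        AlgHom.toLinearMap_apply, smul_eq_mul]
      have hb : sM M.transpose (C (w 0) * X 0 + C (w 1) * X 1) =
          C (M 0 0 * w 0 + M 0 1 * w 1) * X 0 + C (M 1 0 * w 0 + M 1 1 * w 1) * X 1 := by
        rw [map_add (sM _), map_mul (sM _), map_mul (sM _), sM_X, sM_X, sM_C, sM_C]
        simp only [Matrix.transpose_apply, map_add, map_mul]
        ring
      rw [← e2, map_pow (sM _), hb, sub_self]) p hp
    simpa [sub_eq_zero] using this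
  have hh : ∀ i : Fin 2, ∃ a b : ℂ, sM M.transpose (pderiv i Q2) =
      C a * pderiv 0 Q1 + C b * pderiv 1 Q1 := by
    intro i
    have hi : (pderiv i Q2).IsHomogeneous 5 := h2hom.pderiv
    apply keyLemma _ _ hf hg hr l1 k1 p0 hp0 hlp0 _ (sM_hom _ _ _ hi)
    intro q hq
    have hq' := sM_hom (M.transpose)⁻¹ q 3 hq
    have e := hw _ (hi.mul hq')
    rw [map_mul (sM _), sM_inv_right _ hT] at e
    have z : l2 (pderiv i Q2 * sM (M.transpose)⁻¹ q) = 0 := by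
      fin_cases i
      · simpa using k2 (sM (M.transpose)⁻¹ q) 0
      · simpa using k2 0 (sM (M.transpose)⁻¹ q)
    rw [z] at e
    exact (mul_eq_zero.mp e.symm).resolve_left hc
  choose a b hab using hh
  have hfin : LinEquiv Q1 (sM M.transpose Q2) := by
    apply final_step Q1 _ h1hom (sM_hom _ _ _ h2hom) h1sf (sM_sf _ hT _ h2sf)
      (Matrix.of fun i j => if j = 0 then M i 0 * a 0 + M i 1 * a 1 else M i 0 * b 0 + M i 1 * b 1)
    intro i
    rw [pderiv_sM, hab 0, hab 1]
    simp
    ring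
  have q2 : LinEquiv Q2 (sM M.transpose Q2) := ⟨_, hT, rfl⟩
  exact hfin.comp q2.flip
end

section
/- Every binary sextic is linearly equivalent either to a sextic in Sylvester Canonical Form or to one of the following seven sextics: (i) z1^4 z2^2, (ii) z1^4(z1^2+z2^2), (iii) z1^3 z2^3, (iv) z1^5 z2, (v) z1(z1^5+z2^5), (vi) 2z1^6+18z1^5z2+10z1^3z2^3−z2^6, (vii) 184z1^6−192z1^5z2−300z1^4z2^2−320z1^3z2^3−150z1^2z2^4−48z1z2^5+23z2^6. -/
open MvPolynomial

/-- A binary sextic is in Sylvester Canonical Form if it equals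
`a u^6 + b v^6 + c w^6 + d uvw (u−v)(v−w)(w−u)` for linear forms `u, v, w` with
`u + v + w = 0`, any two of which are linearly independent. -/
def IsSylvester (S : MvPolynomial (Fin 2) ℂ) : Prop :=
  ∃ (a b c d : ℂ) (u v w : MvPolynomial (Fin 2) ℂ),
    u.IsHomogeneous 1 ∧ v.IsHomogeneous 1 ∧ w.IsHomogeneous 1 ∧
    u + v + w = 0 ∧
    LinearIndependent ℂ ![u, v] ∧ LinearIndependent ℂ ![v, w] ∧
    LinearIndependent ℂ ![u, w] ∧
    S = MvPolynomial.C a * u ^ 6 + MvPolynomial.C b * v ^ 6 + MvPolynomial.C c * w ^ 6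
        + MvPolynomial.C d * (u * v * w * (u - v) * (v - w) * (w - u))

/-- The seven exceptional binary sextics of Theorem 5.2. -/
noncomputable def exceptionalSextic : Fin 7 → MvPolynomial (Fin 2) ℂ :=
  ![X 0 ^ 4 * X 1 ^ 2,
    X 0 ^ 4 * (X 0 ^ 2 + X 1 ^ 2),
    X 0 ^ 3 * X 1 ^ 3,
    X 0 ^ 5 * X 1,
    X 0 * (X 0 ^ 5 + X 1 ^ 5),
    2 * X 0 ^ 6 + 18 * X 0 ^ 5 * X 1 + 10 * X 0 ^ 3 * X 1 ^ 3 - X 1 ^ 6,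
    184 * X 0 ^ 6 - 192 * X 0 ^ 5 * X 1 - 300 * X 0 ^ 4 * X 1 ^ 2 - 320 * X 0 ^ 3 * X 1 ^ 3
      - 150 * X 0 ^ 2 * X 1 ^ 4 - 48 * X 0 * X 1 ^ 5 + 23 * X 1 ^ 6]

set_option linter.unusedVariables false

theorem substMat_comp (M N : Matrix (Fin 2) (Fin 2) ℂ) (Q : MvPolynomial (Fin 2) ℂ) :
    substMat N (substMat M Q) = substMat (M * N) Q := by
  have : (aeval (fun i => MvPolynomial.C (N i 0) * X 0 + MvPolynomial.C (N i 1) * X 1) :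
      MvPolynomial (Fin 2) ℂ →ₐ[ℂ] MvPolynomial (Fin 2) ℂ).comp
      (aeval (fun i => MvPolynomial.C (M i 0) * X 0 + MvPolynomial.C (M i 1) * X 1))
      = aeval (fun i => MvPolynomial.C ((M * N) i 0) * X 0
          + MvPolynomial.C ((M * N) i 1) * X 1) := by
    apply MvPolynomial.algHom_ext
    intro i
    simp only [AlgHom.comp_apply, aeval_X, map_add, map_mul, aeval_C, Matrix.mul_apply,
      Fin.sum_univ_two, MvPolynomial.algebraMap_eq]
    ring
  exact DFunLike.congr_fun this Q

theorem substMat_one (Q : MvPolynomial (Fin 2) ℂ) : substMat 1 Q = Q := by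
  have : (aeval (fun i => MvPolynomial.C ((1 : Matrix (Fin 2) (Fin 2) ℂ) i 0) * X 0
      + MvPolynomial.C ((1 : Matrix (Fin 2) (Fin 2) ℂ) i 1) * X 1) :
      MvPolynomial (Fin 2) ℂ →ₐ[ℂ] MvPolynomial (Fin 2) ℂ) = AlgHom.id ℂ _ := by
    apply MvPolynomial.algHom_ext
    intro i
    fin_cases i <;> simp
  unfold substMat
  rw [this]
  rfl

theorem LinEquiv.refl' (Q : MvPolynomial (Fin 2) ℂ) : LinEquiv Q Q :=
  ⟨1, by simp, substMat_one Q⟩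

theorem LinEquiv.trans' {Q R S : MvPolynomial (Fin 2) ℂ} (h : LinEquiv Q R) (k : LinEquiv R S) :
    LinEquiv Q S := by
  obtain ⟨M, hM, rfl⟩ := h
  obtain ⟨N, hN, rfl⟩ := k
  exact ⟨M * N, by rw [Matrix.det_mul]; exact hM.mul hN, (substMat_comp M N Q).symm⟩

theorem LinEquiv.symm' {Q R : MvPolynomial (Fin 2) ℂ} (h : LinEquiv Q R) : LinEquiv R Q := by
  obtain ⟨M, hM, rfl⟩ := h
  refine ⟨M⁻¹, Matrix.isUnit_nonsing_inv_det M hM, ?_⟩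
  rw [substMat_comp, Matrix.mul_nonsing_inv M hM, substMat_one]

/-- The conclusion of the main theorem. -/
def Good (Q : MvPolynomial (Fin 2) ℂ) : Prop :=
  (∃ S, IsSylvester S ∧ LinEquiv Q S) ∨ (∃ i : Fin 7, LinEquiv Q (exceptionalSextic i))

theorem Good.of_equiv {Q R : MvPolynomial (Fin 2) ℂ} (h : LinEquiv Q R) (g : Good R) : Good Q := by
  rcases g with ⟨S, hS, e⟩ | ⟨i, e⟩
  · exact Or.inl ⟨S, hS, h.trans' e⟩
  · exact Or.inr ⟨i, h.trans' e⟩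

/-- The sextic with binomially normalized coefficients. -/
noncomputable def sx (a0 a1 a2 a3 a4 a5 a6 : ℂ) : MvPolynomial (Fin 2) ℂ :=
  C a0 * X 0 ^ 6 + 6 * C a1 * X 0 ^ 5 * X 1 + 15 * C a2 * X 0 ^ 4 * X 1 ^ 2
    + 20 * C a3 * X 0 ^ 3 * X 1 ^ 3 + 15 * C a4 * X 0 ^ 2 * X 1 ^ 4
    + 6 * C a5 * X 0 * X 1 ^ 5 + C a6 * X 1 ^ 6

def sb0 (p q r s a0 a1 a2 a3 a4 a5 a6 : ℂ) : ℂ :=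
    a0*(p^6)
    + a1*(6*p^5*r)
    + a2*(15*p^4*r^2)
    + a3*(20*p^3*r^3)
    + a4*(15*p^2*r^4)
    + a5*(6*p*r^5)
    + a6*(r^6)

def sb1 (p q r s a0 a1 a2 a3 a4 a5 a6 : ℂ) : ℂ :=
    a0*(p^5*q)
    + a1*(5*p^4*r*q + p^5*s)
    + a2*(10*p^3*r^2*q + 5*p^4*r*s)
    + a3*(10*p^2*r^3*q + 10*p^3*r^2*s)
    + a4*(5*p*r^4*q + 10*p^2*r^3*s)
    + a5*(r^5*q + 5*p*r^4*s)
    + a6*(r^5*s)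

def sb2 (p q r s a0 a1 a2 a3 a4 a5 a6 : ℂ) : ℂ :=
    a0*(p^4*q^2)
    + a1*(4*p^3*r*q^2 + 2*p^4*q*s)
    + a2*(6*p^2*r^2*q^2 + 8*p^3*r*q*s + p^4*s^2)
    + a3*(4*p*r^3*q^2 + 12*p^2*r^2*q*s + 4*p^3*r*s^2)
    + a4*(r^4*q^2 + 8*p*r^3*q*s + 6*p^2*r^2*s^2)
    + a5*(2*r^4*q*s + 4*p*r^3*s^2)
    + a6*(r^4*s^2)

def sb3 (p q r s a0 a1 a2 a3 a4 a5 a6 : ℂ) : ℂ :=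
    a0*(p^3*q^3)
    + a1*(3*p^2*r*q^3 + 3*p^3*q^2*s)
    + a2*(3*p*r^2*q^3 + 9*p^2*r*q^2*s + 3*p^3*q*s^2)
    + a3*(r^3*q^3 + 9*p*r^2*q^2*s + 9*p^2*r*q*s^2 + p^3*s^3)
    + a4*(3*r^3*q^2*s + 9*p*r^2*q*s^2 + 3*p^2*r*s^3)
    + a5*(3*r^3*q*s^2 + 3*p*r^2*s^3)
    + a6*(r^3*s^3)

def sb4 (p q r s a0 a1 a2 a3 a4 a5 a6 : ℂ) : ℂ :=
    a0*(p^2*q^4)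
    + a1*(2*p*r*q^4 + 4*p^2*q^3*s)
    + a2*(r^2*q^4 + 8*p*r*q^3*s + 6*p^2*q^2*s^2)
    + a3*(4*r^2*q^3*s + 12*p*r*q^2*s^2 + 4*p^2*q*s^3)
    + a4*(6*r^2*q^2*s^2 + 8*p*r*q*s^3 + p^2*s^4)
    + a5*(4*r^2*q*s^3 + 2*p*r*s^4)
    + a6*(r^2*s^4)

def sb5 (p q r s a0 a1 a2 a3 a4 a5 a6 : ℂ) : ℂ :=
    a0*(p*q^5)
    + a1*(r*q^5 + 5*p*q^4*s)
    + a2*(5*r*q^4*s + 10*p*q^3*s^2)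
    + a3*(10*r*q^3*s^2 + 10*p*q^2*s^3)
    + a4*(10*r*q^2*s^3 + 5*p*q*s^4)
    + a5*(5*r*q*s^4 + p*s^5)
    + a6*(r*s^5)

def sb6 (p q r s a0 a1 a2 a3 a4 a5 a6 : ℂ) : ℂ :=
    a0*(q^6)
    + a1*(6*q^5*s)
    + a2*(15*q^4*s^2)
    + a3*(20*q^3*s^3)
    + a4*(15*q^2*s^4)
    + a5*(6*q*s^5)
    + a6*(s^6)

def cb0 (p q r s c0 c1 c2 c3 : ℂ) : ℂ :=
    c0*(p^3)
    + c1*(3*p^2*r)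
    + c2*(3*p*r^2)
    + c3*(r^3)

def cb1 (p q r s c0 c1 c2 c3 : ℂ) : ℂ :=
    c0*(p^2*q)
    + c1*(2*p*r*q + p^2*s)
    + c2*(r^2*q + 2*p*r*s)
    + c3*(r^2*s)

def cb2 (p q r s c0 c1 c2 c3 : ℂ) : ℂ :=
    c0*(p*q^2)
    + c1*(r*q^2 + 2*p*q*s)
    + c2*(2*r*q*s + p*s^2)
    + c3*(r*s^2)

def cb3 (p q r s c0 c1 c2 c3 : ℂ) : ℂ :=
    c0*(q^3)
    + c1*(3*q^2*s)
    + c2*(3*q*s^2)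
    + c3*(s^3)

/-- Eigenvector equations for the third transvectant with the sextic. -/
def Eig (a0 a1 a2 a3 a4 a5 a6 c0 c1 c2 c3 l : ℂ) : Prop :=
  c0*a3 - 3*c1*a2 + 3*c2*a1 - c3*a0 = l*c0 ∧
  c0*a4 - 3*c1*a3 + 3*c2*a2 - c3*a1 = l*c1 ∧
  c0*a5 - 3*c1*a4 + 3*c2*a3 - c3*a2 = l*c2 ∧
  c0*a6 - 3*c1*a5 + 3*c2*a4 - c3*a3 = l*c3

theorem sx_equiv (p q r s a0 a1 a2 a3 a4 a5 a6 : ℂ) (hd : p * s - q * r ≠ 0) :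
    LinEquiv (sx a0 a1 a2 a3 a4 a5 a6)
      (sx (sb0 p q r s a0 a1 a2 a3 a4 a5 a6) (sb1 p q r s a0 a1 a2 a3 a4 a5 a6)
        (sb2 p q r s a0 a1 a2 a3 a4 a5 a6) (sb3 p q r s a0 a1 a2 a3 a4 a5 a6)
        (sb4 p q r s a0 a1 a2 a3 a4 a5 a6) (sb5 p q r s a0 a1 a2 a3 a4 a5 a6)
        (sb6 p q r s a0 a1 a2 a3 a4 a5 a6)) := by
  refine ⟨!![p, q; r, s], by simpa [Matrix.det_fin_two] using hd, ?_⟩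
  simp only [substMat, sx, map_add, map_mul, map_pow, aeval_X, map_ofNat, aeval_C,
    MvPolynomial.algebraMap_eq, sb0, sb1, sb2, sb3, sb4, sb5, sb6]
  simp only [Matrix.of_apply, Matrix.cons_val_zero, Matrix.cons_val_one, Matrix.cons_val',
    Matrix.cons_val_fin_one]
  ring

theorem sx_equiv' (p q r s : ℂ) {a0 a1 a2 a3 a4 a5 a6 b0 b1 b2 b3 b4 b5 b6 : ℂ}
    (hd : p * s - q * r ≠ 0)
    (h0 : sb0 p q r s a0 a1 a2 a3 a4 a5 a6 = b0) (h1 : sb1 p q r s a0 a1 a2 a3 a4 a5 a6 = b1)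
    (h2 : sb2 p q r s a0 a1 a2 a3 a4 a5 a6 = b2) (h3 : sb3 p q r s a0 a1 a2 a3 a4 a5 a6 = b3)
    (h4 : sb4 p q r s a0 a1 a2 a3 a4 a5 a6 = b4) (h5 : sb5 p q r s a0 a1 a2 a3 a4 a5 a6 = b5)
    (h6 : sb6 p q r s a0 a1 a2 a3 a4 a5 a6 = b6) :
    LinEquiv (sx a0 a1 a2 a3 a4 a5 a6) (sx b0 b1 b2 b3 b4 b5 b6) := by
  have := sx_equiv p q r s a0 a1 a2 a3 a4 a5 a6 hd
  rwa [h0, h1, h2, h3, h4, h5, h6] at this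

theorem exists_sx (Q : MvPolynomial (Fin 2) ℂ) (hQ : Q.IsHomogeneous 6) :
    ∃ a0 a1 a2 a3 a4 a5 a6, Q = sx a0 a1 a2 a3 a4 a5 a6 := by
  let e : ℕ → ℕ → (Fin 2 →₀ ℕ) := fun i j => Finsupp.single 0 i + Finsupp.single 1 j
  have key : ∀ (i j : ℕ) (a : ℂ), C a * (X 0 : MvPolynomial (Fin 2) ℂ) ^ i * X 1 ^ j
      = monomial (e i j) a := by
    intro i j a
    rw [X_pow_eq_monomial, X_pow_eq_monomial, C_mul_monomial, monomial_mul]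
    simp [e]
  refine ⟨coeff (e 6 0) Q, coeff (e 5 1) Q / 6, coeff (e 4 2) Q / 15, coeff (e 3 3) Q / 20,
    coeff (e 2 4) Q / 15, coeff (e 1 5) Q / 6, coeff (e 0 6) Q, ?_⟩
  have : sx (coeff (e 6 0) Q) (coeff (e 5 1) Q / 6) (coeff (e 4 2) Q / 15) (coeff (e 3 3) Q / 20)
    (coeff (e 2 4) Q / 15) (coeff (e 1 5) Q / 6) (coeff (e 0 6) Q)
    = monomial (e 6 0) (coeff (e 6 0) Q) + monomial (e 5 1) (coeff (e 5 1) Q)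
      + monomial (e 4 2) (coeff (e 4 2) Q) + monomial (e 3 3) (coeff (e 3 3) Q)
      + monomial (e 2 4) (coeff (e 2 4) Q) + monomial (e 1 5) (coeff (e 1 5) Q)
      + monomial (e 0 6) (coeff (e 0 6) Q) := by
    simp only [← key]
    have h : ∀ (n : ℕ) [n.AtLeastTwo] (x : ℂ), C x = (OfNat.ofNat n : MvPolynomial (Fin 2) ℂ)
        * C (x / (OfNat.ofNat n : ℂ)) := by
      intro n _ x
      have : (OfNat.ofNat n : MvPolynomial (Fin 2) ℂ) = C (OfNat.ofNat n : ℂ) := (map_ofNat C n).symm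
      rw [this, ← C_mul, mul_div_cancel₀]
      exact OfNat.ofNat_ne_zero n
    rw [h 6 (coeff (e 5 1) Q), h 15 (coeff (e 4 2) Q), h 20 (coeff (e 3 3) Q),
      h 15 (coeff (e 2 4) Q), h 6 (coeff (e 1 5) Q)]
    unfold sx
    ring
  rw [this]
  ext d
  have inj : ∀ i j, e i j = d ↔ i = d 0 ∧ j = d 1 := by
    intro i j
    constructor
    · rintro rfl
      simp [e]
    · rintro ⟨h1, h2⟩
      ext k
      fin_cases k <;> simp [e, h1, h2]
  by_cases hd : d.degree = 6
  · have hd' : d 0 + d 1 = 6 := by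
      rw [← hd, Finsupp.degree_eq_sum, Fin.sum_univ_two]
    have hde : e (d 0) (d 1) = d := (inj _ _).2 ⟨rfl, rfl⟩
    simp only [coeff_add, coeff_monomial, inj]
    have h0 : d 0 ≤ 6 := by omega
    have h1 : d 1 = 6 - d 0 := by omega
    rw [h1] at hde ⊢
    generalize d 0 = k at *
    interval_cases k <;> norm_num at hde ⊢ <;> rw [hde]
  · rw [hQ.coeff_eq_zero hd]
    have hd' : d 0 + d 1 ≠ 6 := by
      rw [Finsupp.degree_eq_sum, Fin.sum_univ_two] at hd
      exact hd
    simp only [coeff_add, coeff_monomial, inj]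
    rw [if_neg (by omega), if_neg (by omega), if_neg (by omega), if_neg (by omega),
      if_neg (by omega), if_neg (by omega), if_neg (by omega)]
    simp

theorem eig_transfer (p q r s a0 a1 a2 a3 a4 a5 a6 c0 c1 c2 c3 l : ℂ) (h : Eig a0 a1 a2 a3 a4 a5 a6 c0 c1 c2 c3 l) :
    Eig (sb0 p q r s a0 a1 a2 a3 a4 a5 a6) (sb1 p q r s a0 a1 a2 a3 a4 a5 a6) (sb2 p q r s a0 a1 a2 a3 a4 a5 a6) (sb3 p q r s a0 a1 a2 a3 a4 a5 a6) (sb4 p q r s a0 a1 a2 a3 a4 a5 a6) (sb5 p q r s a0 a1 a2 a3 a4 a5 a6) (sb6 p q r s a0 a1 a2 a3 a4 a5 a6)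
      (cb0 p q r s c0 c1 c2 c3) (cb1 p q r s c0 c1 c2 c3) (cb2 p q r s c0 c1 c2 c3) (cb3 p q r s c0 c1 c2 c3) (l * (p*s-q*r)^3) := by
  obtain ⟨h0, h1, h2, h3⟩ := h
  refine ⟨?_, ?_, ?_, ?_⟩
  · simp only [sb0, sb1, sb2, sb3, cb0, cb1, cb2, cb3]
    linear_combination (p*s-q*r)^3*(p^3)*h0 + (p*s-q*r)^3*(3*p^2*r)*h1 + (p*s-q*r)^3*(3*p*r^2)*h2 + (p*s-q*r)^3*(r^3)*h3
  · simp only [sb1, sb2, sb3, sb4, cb0, cb1, cb2, cb3]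
    linear_combination (p*s-q*r)^3*(p^2*q)*h0 + (p*s-q*r)^3*(2*p*r*q + p^2*s)*h1 + (p*s-q*r)^3*(r^2*q + 2*p*r*s)*h2 + (p*s-q*r)^3*(r^2*s)*h3
  · simp only [sb2, sb3, sb4, sb5, cb0, cb1, cb2, cb3]
    linear_combination (p*s-q*r)^3*(p*q^2)*h0 + (p*s-q*r)^3*(r*q^2 + 2*p*q*s)*h1 + (p*s-q*r)^3*(2*r*q*s + p*s^2)*h2 + (p*s-q*r)^3*(r*s^2)*h3
  · simp only [sb3, sb4, sb5, sb6, cb0, cb1, cb2, cb3]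
    linear_combination (p*s-q*r)^3*(q^3)*h0 + (p*s-q*r)^3*(3*q^2*s)*h1 + (p*s-q*r)^3*(3*q*s^2)*h2 + (p*s-q*r)^3*(s^3)*h3

/-- Discriminant of a binary cubic. -/
def dsc (c0 c1 c2 c3 : ℂ) : ℂ :=
  c0^2*c3^2 - 6*c0*c1*c2*c3 + 4*c0*c2^3 + 4*c1^3*c3 - 3*c1^2*c2^2

theorem dsc_act (p q r s c0 c1 c2 c3 : ℂ) :
    dsc (cb0 p q r s c0 c1 c2 c3) (cb1 p q r s c0 c1 c2 c3) (cb2 p q r s c0 c1 c2 c3)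
      (cb3 p q r s c0 c1 c2 c3) = (p*s-q*r)^6 * dsc c0 c1 c2 c3 := by
  simp only [dsc, cb0, cb1, cb2, cb3]
  ring

/-- Normal forms of nonzero binary cubics. -/
def NF (c0 c1 c2 c3 : ℂ) : Prop :=
  (c0 ≠ 0 ∧ c1 = 0 ∧ c2 = 0 ∧ c3 = 0) ∨ (c0 = 0 ∧ c1 ≠ 0 ∧ c2 = 0 ∧ c3 = 0) ∨
    (c0 = 0 ∧ c1 ≠ 0 ∧ c2 = 0 ∧ c3 = -3 * c1)

def Red (c0 c1 c2 c3 : ℂ) : Prop :=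
  ∃ p q r s : ℂ, p * s - q * r ≠ 0 ∧ NF (cb0 p q r s c0 c1 c2 c3) (cb1 p q r s c0 c1 c2 c3)
    (cb2 p q r s c0 c1 c2 c3) (cb3 p q r s c0 c1 c2 c3)

theorem Red.of_act (p q r s c0 c1 c2 c3 : ℂ) (hd : p * s - q * r ≠ 0)
    (h : Red (cb0 p q r s c0 c1 c2 c3) (cb1 p q r s c0 c1 c2 c3) (cb2 p q r s c0 c1 c2 c3)
      (cb3 p q r s c0 c1 c2 c3)) : Red c0 c1 c2 c3 := by
  obtain ⟨p', q', r', s', hd', h⟩ := h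
  refine ⟨p*p'+q*r', p*q'+q*s', r*p'+s*r', r*q'+s*s', ?_, ?_⟩
  · have : (p*p'+q*r') * (r*q'+s*s') - (p*q'+q*s')*(r*p'+s*r')
      = (p * s - q * r) * (p' * s' - q' * r') := by ring
    rw [this]
    exact mul_ne_zero hd hd'
  · convert h using 1 <;> simp only [cb0, cb1, cb2, cb3] <;> ring

theorem red_zero (c1 c2 c3 : ℂ) (h : ¬ (c1 = 0 ∧ c2 = 0 ∧ c3 = 0)) : Red 0 c1 c2 c3 := by
  by_cases h1 : c1 = 0
  · subst h1
    by_cases h2 : c2 = 0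
    · subst h2
      refine ⟨0, 1, 1, 0, by norm_num, Or.inl ?_⟩
      simp_all [cb0, cb1, cb2, cb3]
    · refine ⟨-c3/(3*c2), 1, 1, 0, by norm_num, Or.inr (Or.inl ?_)⟩
      refine ⟨?_, ?_, ?_, ?_⟩ <;> simp only [cb0, cb1, cb2, cb3]
      · field_simp
        ring
      · ring_nf
        exact h2
      · ring
      · ring
  · by_cases he : 3*c1*(-c2/(2*c1))^2 + 3*c2*(-c2/(2*c1)) + c3 = 0
    · refine ⟨1, -c2/(2*c1), 0, 1, by norm_num, Or.inr (Or.inl ?_)⟩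
      refine ⟨?_, ?_, ?_, ?_⟩ <;> simp only [cb0, cb1, cb2, cb3]
      · ring
      · ring_nf
        exact h1
      · field_simp
        ring
      · linear_combination he
    · obtain ⟨σ, hσ⟩ := IsAlgClosed.exists_pow_nat_eq
        (-(3*c1*(-c2/(2*c1))^2 + 3*c2*(-c2/(2*c1)) + c3)/(3*c1)) (n := 2) (by norm_num)
      have hσ0 : σ ≠ 0 := by
        rintro rfl
        apply he
        have : (3*c1) ≠ 0 := by simpa using h1
        field_simp at hσ
        field_simp
        linear_combination hσ
      have hσ2 : 3 * c1 * σ^2 = -(3*c1*(-c2/(2*c1))^2 + 3*c2*(-c2/(2*c1)) + c3) := by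
        rw [hσ]
        field_simp
      refine ⟨σ, -c2/(2*c1), 0, 1, by simpa using hσ0, Or.inr (Or.inr ?_)⟩
      refine ⟨?_, ?_, ?_, ?_⟩ <;> simp only [cb0, cb1, cb2, cb3]
      · ring
      · have : 0 * (σ ^ 2 * (-c2 / (2 * c1))) + c1 * (2 * σ * 0 * (-c2 / (2 * c1)) + σ ^ 2 * 1)
          = c1 * σ^2 := by ring
        ring_nf
        simp [h1, hσ0]
      · field_simp
        ring
      · linear_combination hσ2

theorem red_all (c0 c1 c2 c3 : ℂ) (h : ¬ (c0 = 0 ∧ c1 = 0 ∧ c2 = 0 ∧ c3 = 0)) :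
    Red c0 c1 c2 c3 := by
  by_cases h0 : c0 = 0
  · subst h0
    apply red_zero
    simpa using h
  · obtain ⟨x, hx⟩ : ∃ x : ℂ, c0*x^3 + 3*c1*x^2 + 3*c2*x + c3 = 0 := by
      have hdeg : (Polynomial.C c0 * Polynomial.X^3 + Polynomial.C (3*c1) * Polynomial.X^2
        + Polynomial.C (3*c2) * Polynomial.X + Polynomial.C c3).degree = 3 :=
        Polynomial.degree_cubic h0
      obtain ⟨x, hx⟩ := IsAlgClosed.exists_root _ (by rw [hdeg]; norm_num)
      refine ⟨x, ?_⟩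
      simpa [Polynomial.IsRoot] using hx
    apply Red.of_act x 1 1 0 c0 c1 c2 c3 (by norm_num)
    have e0 : cb0 x 1 1 0 c0 c1 c2 c3 = 0 := by
      simp only [cb0]
      linear_combination hx
    rw [e0]
    apply red_zero
    simp only [cb1, cb2, cb3]
    rintro ⟨h1, h2, h3⟩
    apply h0
    linear_combination h3

theorem good_sylvester {Q : MvPolynomial (Fin 2) ℂ} (h : IsSylvester Q) : Good Q :=
  Or.inl ⟨Q, h, LinEquiv.refl' Q⟩

theorem linInd_aux (p q r s : ℂ) (h : p * s - q * r ≠ 0) :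
    LinearIndependent ℂ ![C p * X 0 + C q * X 1, (C r * X 0 + C s * X 1 : MvPolynomial (Fin 2) ℂ)] := by
  rw [LinearIndependent.pair_iff]
  intro x y hxy
  have h1 := congrArg (eval ![1, 0]) hxy
  have h2 := congrArg (eval ![0, 1]) hxy
  simp [smul_eval] at h1 h2
  constructor
  · apply (mul_eq_zero.1 (_ : (p * s - q * r) * x = 0)).resolve_left h
    linear_combination s * h1 - r * h2
  · apply (mul_eq_zero.1 (_ : (p * s - q * r) * y = 0)).resolve_left h
    linear_combination p * h2 - q * h1

theorem hom_aux (p q : ℂ) : (C p * X 0 + C q * X 1 : MvPolynomial (Fin 2) ℂ).IsHomogeneous 1 := by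
  apply IsHomogeneous.add
  · simpa using (isHomogeneous_C (Fin 2) p).mul (isHomogeneous_X ℂ (0 : Fin 2))
  · simpa using (isHomogeneous_C (Fin 2) q).mul (isHomogeneous_X ℂ (1 : Fin 2))

theorem good_two (a0 a6 : ℂ) : Good (sx a0 0 0 0 0 0 a6) := by
  apply good_sylvester
  refine ⟨a0, a6, 0, 0, C 1 * X 0 + C 0 * X 1, C 0 * X 0 + C 1 * X 1, C (-1) * X 0 + C (-1) * X 1,
    hom_aux _ _, hom_aux _ _, hom_aux _ _, ?_, linInd_aux _ _ _ _ (by norm_num),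
    linInd_aux _ _ _ _ (by norm_num), linInd_aux _ _ _ _ (by norm_num), ?_⟩
  · simp only [map_one, map_zero, map_neg]
    ring
  · simp [sx]

theorem good_three (a0 a1 a3 a6 : ℂ) : Good (sx a0 a1 a0 a3 a0 (3*a1-2*a3) a6) := by
  apply good_sylvester
  refine ⟨(a6 - a0)/64, (a0 + (3*a1+a3)/4)/2, (a0 - (3*a1+a3)/4)/2, 3*(a1-a3)/8,
    C 0 * X 0 + C (-2) * X 1, C 1 * X 0 + C 1 * X 1, C (-1) * X 0 + C 1 * X 1,
    hom_aux _ _, hom_aux _ _, hom_aux _ _, ?_, linInd_aux _ _ _ _ (by norm_num),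
    linInd_aux _ _ _ _ (by norm_num), linInd_aux _ _ _ _ (by norm_num), ?_⟩
  · simp only [map_one, map_zero, map_neg, map_ofNat]
    ring
  · obtain ⟨b, rfl⟩ : ∃ b, a0 = 64 * b := ⟨a0/64, by ring⟩
    obtain ⟨d, rfl⟩ : ∃ d, a1 = 64 * d := ⟨a1/64, by ring⟩
    obtain ⟨e, rfl⟩ : ∃ e, a3 = 64 * e := ⟨a3/64, by ring⟩
    obtain ⟨f, rfl⟩ : ∃ f, a6 = 64 * f := ⟨a6/64, by ring⟩
    have e1 : (64 * f - 64 * b)/64 = f - b := by ring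
    have e2 : (64 * b + (3*(64*d)+64*e)/4)/2 = 32*b+24*d+8*e := by ring
    have e3 : (64 * b - (3*(64*d)+64*e)/4)/2 = 32*b-24*d-8*e := by ring
    have e4 : 3*(64*d-64*e)/8 = 24*(d-e) := by ring
    rw [e1, e2, e3, e4]
    simp only [sx, map_add, map_sub, map_mul, map_neg, map_ofNat, map_one, map_zero]
    ring

/-- An eigenvector with nonzero discriminant gives a Sylvester form. -/
theorem good_of_dsc {a0 a1 a2 a3 a4 a5 a6 : ℂ} (c0 c1 c2 c3 l : ℂ)
    (h : Eig a0 a1 a2 a3 a4 a5 a6 c0 c1 c2 c3 l) (hd : dsc c0 c1 c2 c3 ≠ 0) :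
    Good (sx a0 a1 a2 a3 a4 a5 a6) := by
  have hc : ¬ (c0 = 0 ∧ c1 = 0 ∧ c2 = 0 ∧ c3 = 0) := by
    rintro ⟨rfl, rfl, rfl, rfl⟩
    simp [dsc] at hd
  obtain ⟨p, q, r, s, hdet, hN⟩ := red_all c0 c1 c2 c3 hc
  have hE := eig_transfer p q r s a0 a1 a2 a3 a4 a5 a6 c0 c1 c2 c3 l h
  have hD := dsc_act p q r s c0 c1 c2 c3
  have hne : (p*s-q*r)^6 * dsc c0 c1 c2 c3 ≠ 0 := mul_ne_zero (pow_ne_zero _ hdet) hd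
  rw [← hD] at hne
  refine Good.of_equiv (sx_equiv p q r s a0 a1 a2 a3 a4 a5 a6 hdet) ?_
  generalize sb0 p q r s a0 a1 a2 a3 a4 a5 a6 = b0 at *
  generalize sb1 p q r s a0 a1 a2 a3 a4 a5 a6 = b1 at *
  generalize sb2 p q r s a0 a1 a2 a3 a4 a5 a6 = b2 at *
  generalize sb3 p q r s a0 a1 a2 a3 a4 a5 a6 = b3 at *
  generalize sb4 p q r s a0 a1 a2 a3 a4 a5 a6 = b4 at *
  generalize sb5 p q r s a0 a1 a2 a3 a4 a5 a6 = b5 at *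
  generalize sb6 p q r s a0 a1 a2 a3 a4 a5 a6 = b6 at *
  generalize cb0 p q r s c0 c1 c2 c3 = d0 at *
  generalize cb1 p q r s c0 c1 c2 c3 = d1 at *
  generalize cb2 p q r s c0 c1 c2 c3 = d2 at *
  generalize cb3 p q r s c0 c1 c2 c3 = d3 at *
  generalize l * (p*s-q*r)^3 = m at *
  rcases hN with ⟨h0, rfl, rfl, rfl⟩ | ⟨rfl, h1, rfl, rfl⟩ | ⟨rfl, h1, rfl, rfl⟩
  · simp [dsc] at hne
  · simp [dsc] at hne
  · obtain ⟨e0, e1, e2, e3⟩ := hE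
    have f2 : b2 = b0 := mul_left_cancel₀ h1 (by linear_combination -e0/3)
    have f4 : b4 = b0 := mul_left_cancel₀ h1 (by linear_combination -e0/3 - e2/3)
    have f5 : b5 = 3*b1-2*b3 := mul_left_cancel₀ h1 (by linear_combination -e3/3 - e1)
    rw [f2, f4, f5]
    exact good_three b0 b1 b3 b6

theorem diag_equiv_s4 (a0 a1 a3 a6 b0 b1 b3 b6 : ℂ) (ha1 : a1 ≠ 0) (ha3 : a3 ≠ 0) (ha6 : a6 ≠ 0)
    (hb1 : b1 ≠ 0) (hb3 : b3 ≠ 0) (hb6 : b6 ≠ 0)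
    (h1 : a0*a6*b3^2 = b0*b6*a3^2) (h2 : a1^3*a6^2*b3^5 = b1^3*b6^2*a3^5) :
    LinEquiv (sx a0 a1 0 a3 0 0 a6) (sx b0 b1 0 b3 0 0 b6) := by
  obtain ⟨t, ht⟩ := IsAlgClosed.exists_pow_nat_eq (b6/a6) (n := 6) (by norm_num)
  have ht' : t^6*a6 = b6 := by
    rw [ht]
    field_simp
  have ht0 : t ≠ 0 := by
    rintro rfl
    apply hb6
    rw [← ht']
    ring
  obtain ⟨s, hs⟩ := IsAlgClosed.exists_pow_nat_eq (b3/(a3*t^3)) (n := 3) (by norm_num)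
  have hs' : s^3*t^3*a3 = b3 := by
    rw [hs]
    field_simp
  have hs0 : s ≠ 0 := by
    rintro rfl
    apply hb3
    rw [← hs']
    ring
  subst hs' ht'
  have h3 : a1^3*s^15*t^3 = b1^3 := by
    have hne : a6^2*a3^5*t^12 ≠ 0 := by positivity
    apply mul_left_cancel₀ hne
    linear_combination h2
  have h4 : s^6*a0 = b0 := by
    have hne : a6*a3^2*t^6 ≠ 0 := by positivity
    apply mul_left_cancel₀ hne
    linear_combination h1
  obtain ⟨ζ, hζ⟩ : ∃ ζ, ζ*(a1*s^5*t) = b1 := ⟨b1/(a1*s^5*t), by field_simp⟩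
  have hζ3 : ζ^3 = 1 := by
    have hne : a1^3*s^15*t^3 ≠ 0 := by positivity
    apply mul_left_cancel₀ hne
    have : (ζ*(a1*s^5*t))^3 = b1^3 := by rw [hζ]
    linear_combination this - h3
  have hζ0 : ζ ≠ 0 := by
    rintro rfl
    norm_num at hζ3
  refine sx_equiv' (s*ζ^2) 0 0 t ?_ ?_ ?_ ?_ ?_ ?_ ?_ ?_
  · simp [hs0, ht0, hζ0]
  · simp only [sb0]
    linear_combination h4 + a0*s^6*(ζ^9+ζ^6+ζ^3+1)*hζ3
  · simp only [sb1]
    linear_combination hζ + a1*s^5*t*(ζ^7+ζ^4+ζ)*hζ3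
  · simp only [sb2]
    ring
  · simp only [sb3]
    linear_combination a3*s^3*t^3*(ζ^3+1)*hζ3
  · simp only [sb4]
    ring
  · simp only [sb5]
    ring
  · simp only [sb6]
    ring

theorem seven_equiv (θ : ℂ) (hθ : θ^4 = 7) :
    LinEquiv (sx 184 (-32) (-20) (-16) (-10) (-8) 23)
      (sx ((1583253504) + (973364224)*θ + (598413312)*θ^2 + (367897600)*θ^3)
        ((-264954368) + (-162896384)*θ + (-100147712)*θ^2 + (-61569536)*θ^3) 0
        ((-3361792) + (-2157568)*θ + (-1308160)*θ^2 + (-813568)*θ^3) 0 0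
        ((315707392) + (-188561408)*θ + (117182464)*θ^2 + (-73816064)*θ^3)) := by
  refine sx_equiv' ((4) + (3)*θ + (2)*θ^2 + (1)*θ^3) ((-2) + (1)*θ + (-2)*θ^2 + (1)*θ^3) 2 6 ?_ ?_ ?_ ?_ ?_ ?_ ?_ ?_
  · apply left_ne_zero_of_mul_eq_one (b := (-1/72) + (-1/72)*θ + (1/72)*θ^2 + (1/504)*θ^3)
    linear_combination ((25/126) + (11/126)*θ + (1/126)*θ^2) * hθ
  · simp only [sb0]
    linear_combination ((226201024) + (138971392)*θ + (85032096)*θ^2 + (51406720)*θ^3 + (30284752)*θ^4 + (17075008)*θ^5 + (9026680)*θ^6 + (4382368)*θ^7 + (1914400)*θ^8 + (736224)*θ^9 + (243088)*θ^10 + (66592)*θ^11 + (14352)*θ^12 + (2208)*θ^13 + (184)*θ^14) * hθ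
  · simp only [sb1]
    linear_combination ((-37722048) + (-22852032)*θ + (-13492896)*θ^2 + (-7552128)*θ^3 + (-3870224)*θ^4 + (-1707376)*θ^5 + (-564984)*θ^6 + (-67632)*θ^7 + (83472)*θ^8 + (85392)*θ^9 + (49888)*θ^10 + (21200)*θ^11 + (6624)*θ^12 + (1472)*θ^13 + (184)*θ^14) * hθ
  · simp only [sb2]
    linear_combination ((-9408) + (13440)*θ + (-60640)*θ^2 + (-136576)*θ^3 + (-191824)*θ^4 + (-220384)*θ^5 + (-177672)*θ^6 + (-119424)*θ^7 + (-61024)*θ^8 + (-20608)*θ^9 + (-3184)*θ^10 + (2304)*θ^11 + (1840)*θ^12 + (736)*θ^13 + (184)*θ^14) * hθ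
  · simp only [sb3]
    linear_combination ((-458304) + (-258496)*θ + (-95776)*θ^2 + (-60864)*θ^3 + (32208)*θ^4 + (24176)*θ^5 + (19528)*θ^6 + (15984)*θ^7 + (-5616)*θ^8 + (-3024)*θ^9 + (-4448)*θ^10 + (-1872)*θ^11 + (184)*θ^14) * hθ
  · simp only [sb4]
    linear_combination ((-28224) + (10752)*θ + (-41184)*θ^2 + (-4992)*θ^3 + (-55024)*θ^4 + (33280)*θ^5 + (-42888)*θ^6 + (19808)*θ^7 + (-2912)*θ^8 + (-480)*θ^9 + (4880)*θ^10 + (-3104)*θ^11 + (1104)*θ^12 + (-736)*θ^13 + (184)*θ^14) * hθ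
  · simp only [sb5]
    linear_combination ((-47040) + (1344)*θ + (39136)*θ^2 + (-46592)*θ^3 + (70960)*θ^4 + (-71344)*θ^5 + (78472)*θ^6 + (-89840)*θ^7 + (80528)*θ^8 + (-57392)*θ^9 + (30688)*θ^10 + (-13168)*θ^11 + (5152)*θ^12 + (-1472)*θ^13 + (184)*θ^14) * hθ
  · simp only [sb6]
    linear_combination ((44890944) + (-26907776)*θ + (16667296)*θ^2 + (-10451584)*θ^3 + (6277872)*θ^4 + (-3649568)*θ^5 + (2148856)*θ^6 + (-1252288)*θ^7 + (669984)*θ^8 + (-312384)*θ^9 + (125968)*θ^10 + (-43840)*θ^11 + (12144)*θ^12 + (-2208)*θ^13 + (184)*θ^14) * hθ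

theorem seven_diag (θ a0 a1 a6 : ℂ) (hθ : θ^4 = 7) (h1 : a1 ≠ 0) (h6 : a6 ≠ 0)
    (hp : a0*a6 = 24 + 8*θ^2) (hq : a1^3*a6^2 = 2176 + 832*θ^2) :
    LinEquiv (sx a0 a1 0 1 0 0 a6) (sx 184 (-32) (-20) (-16) (-10) (-8) 23) := by
  refine LinEquiv.trans' ?_ (seven_equiv θ hθ).symm'
  apply diag_equiv_s4 _ _ _ _ _ _ _ _ h1 one_ne_zero h6
  · apply left_ne_zero_of_mul_eq_one (b := (41/580608) + (-13/580608)*θ + (-5/1016064)*θ^2 + (-5/1016064)*θ^3)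
    linear_combination ((3031169/1134) + (64460/81)*θ + (171790/567)*θ^2) * hθ
  · apply left_ne_zero_of_mul_eq_one (b := (11/1741824) + (-1/1741824)*θ + (-17/12192768)*θ^2 + (-5/12192768)*θ^3)
    linear_combination ((5402/1701) + (406/243)*θ + (1135/3402)*θ^2) * hθ
  · apply left_ne_zero_of_mul_eq_one (b := (19/94058496) + (17/188116992)*θ + (41/658409472)*θ^2 + (67/1316818944)*θ^3)
    linear_combination ((-411857/45927) + (8960/6561)*θ + (-344983/91854)*θ^2) * hθ
  · linear_combination ((-3361792) + (-2157568)*θ + (-1308160)*θ^2 + (-813568)*θ^3)^2 * hp + ((71367656447410176) + (1201373219651584)*θ + (27214413729628160)*θ^2 + (17028433838080)*θ^3 + (5295143124992)*θ^4) * hθ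
  · linear_combination ((-3361792) + (-2157568)*θ + (-1308160)*θ^2 + (-813568)*θ^3)^5 * hq + ((-264840557379325080005081840068283217215488) + (-172118178300243288591709555073774155464704)*θ + (-308210280591657867529460374672179741065216)*θ^2 + (-193572727264102141738322976935037351493632)*θ^3 + (-82306418583331636732839700060591569764352)*θ^4 + (-48358311699237793348791691264394491068416)*θ^5 + (27847914654994295848276781683469111525376)*θ^6 + (18132388103649700082468208032395472928768)*θ^7 + (16782589791131370376236406354722288566272)*θ^8 + (10187085271686876475449833053158018908160)*θ^9 + (2167956019321168233796527596052890517504)*θ^10 + (1271730784743430298184718621321228976128)*θ^11 + (-2384128332340463844792389441945600)*θ^12 + (-296546373392485091927601316888576)*θ^13) * hθ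

theorem ex5_eq : exceptionalSextic 5 = sx 2 3 0 (1/2) 0 0 (-1) := by
  have : (20 : MvPolynomial (Fin 2) ℂ) * C (1/2) = 10 := by
    have e : (20 : MvPolynomial (Fin 2) ℂ) = C 20 := (map_ofNat C 20).symm
    have e' : (10 : MvPolynomial (Fin 2) ℂ) = C 10 := (map_ofNat C 10).symm
    rw [e, e', ← C_mul]
    norm_num
  simp only [sx, this]
  simp only [exceptionalSextic, map_zero, map_one, map_neg, map_ofNat, Matrix.cons_val]
  ring

theorem ex6_eq : exceptionalSextic 6 = sx 184 (-32) (-20) (-16) (-10) (-8) 23 := by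
  simp only [sx, exceptionalSextic, map_neg, map_ofNat, Matrix.cons_val]
  ring

theorem ex4_eq : exceptionalSextic 4 = sx 1 0 0 0 0 (1/6) 0 := by
  have : (6 : MvPolynomial (Fin 2) ℂ) * C (1/6) = 1 := by
    have e : (6 : MvPolynomial (Fin 2) ℂ) = C 6 := (map_ofNat C 6).symm
    rw [e, ← C_mul]
    norm_num
  simp only [sx, this]
  simp only [exceptionalSextic, map_zero, map_one, Matrix.cons_val]
  ring

theorem ex3_eq : exceptionalSextic 3 = sx 0 (1/6) 0 0 0 0 0 := by
  have : (6 : MvPolynomial (Fin 2) ℂ) * C (1/6) = 1 := by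
    have e : (6 : MvPolynomial (Fin 2) ℂ) = C 6 := (map_ofNat C 6).symm
    rw [e, ← C_mul]
    norm_num
  simp only [sx, this]
  simp only [exceptionalSextic, map_zero, Matrix.cons_val]
  ring

theorem ex2_eq : exceptionalSextic 2 = sx 0 0 0 (1/20) 0 0 0 := by
  have : (20 : MvPolynomial (Fin 2) ℂ) * C (1/20) = 1 := by
    have e : (20 : MvPolynomial (Fin 2) ℂ) = C 20 := (map_ofNat C 20).symm
    rw [e, ← C_mul]
    norm_num
  simp only [sx, this]
  simp only [exceptionalSextic, map_zero, Matrix.cons_val]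
  ring

theorem ex1_eq : exceptionalSextic 1 = sx 1 0 (1/15) 0 0 0 0 := by
  have : (15 : MvPolynomial (Fin 2) ℂ) * C (1/15) = 1 := by
    have e : (15 : MvPolynomial (Fin 2) ℂ) = C 15 := (map_ofNat C 15).symm
    rw [e, ← C_mul]
    norm_num
  simp only [sx, this]
  simp only [exceptionalSextic, map_zero, map_one, Matrix.cons_val]
  ring

theorem ex0_eq : exceptionalSextic 0 = sx 0 0 (1/15) 0 0 0 0 := by
  have : (15 : MvPolynomial (Fin 2) ℂ) * C (1/15) = 1 := by
    have e : (15 : MvPolynomial (Fin 2) ℂ) = C 15 := (map_ofNat C 15).symm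
    rw [e, ← C_mul]
    norm_num
  simp only [sx, this]
  simp only [exceptionalSextic, map_zero, Matrix.cons_val]
  ring

theorem caseA_main (a0 a1 a6 : ℂ) (ha1 : a1 ≠ 0) (ha6 : a6 ≠ 0)
    (D : ∀ c0 c1 c2 c3 l, Eig a0 a1 0 1 0 0 a6 c0 c1 c2 c3 l → dsc c0 c1 c2 c3 = 0) :
    Good (sx a0 a1 0 1 0 0 a6) := by
  obtain ⟨μ, hμ⟩ := IsAlgClosed.exists_pow_nat_eq (1 - a0*a6) (n := 2) (by norm_num)
  have h3 := D 4 (-a1*a6/6) ((8+a0*a6)/(3*a1)) a6 3 (by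
    refine ⟨?_, ?_, ?_, ?_⟩
    · field_simp
      ring
    · ring
    · field_simp
      ring
    · ring)
  obtain ⟨Q, hQ⟩ : ∃ Q, Q = a1^3*a6^2 := ⟨_, rfl⟩
  have hQ0 : Q ≠ 0 := by
    rw [hQ]
    positivity
  have e3 : 1728*Q + 144*(9-μ^2)*Q + 64*(9-μ^2)^3 - 2*Q^2 - (9-μ^2)^2*Q = 0 := by
    have hm : 9 - μ^2 = 8 + a0*a6 := by rw [hμ]; ring
    rw [hm, hQ]
    have : 108*a1^3*dsc 4 (-a1*a6/6) ((8+a0*a6)/(3*a1)) a6 = 0 := by rw [h3]; ring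
    rw [← this, dsc]
    field_simp
    ring
  have key : ∀ ν : ℂ, ν^2 = 1 - a0*a6 → 3 + ν ≠ 0 → 3 - ν ≠ 0 →
      4*Q = (1+ν)^2*(3+ν)^3 := by
    intro ν hν h1 h2
    have h := D ((1+ν)*(3+ν)) (-a1*a6) 0 (a6*(3+ν)) ν (by
      refine ⟨?_, ?_, ?_, ?_⟩
      · linear_combination -(3+ν)*hν
      · ring
      · ring
      · ring)
    have hne : a6^2*(3+ν) ≠ 0 := by positivity
    apply mul_left_cancel₀ hne
    rw [hQ]
    rw [dsc] at h
    linear_combination -h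
  by_cases h9 : μ^2 = 9
  · have hq : Q = 864 := by
      rw [h9] at e3
      apply mul_left_cancel₀ hQ0
      linear_combination -e3/2
    refine Or.inr ⟨5, ?_⟩
    rw [ex5_eq]
    apply diag_equiv_s4 _ _ _ _ _ _ _ _ ha1 one_ne_zero ha6 (by norm_num) (by norm_num) (by norm_num)
    · linear_combination (hμ - h9)/4
    · linear_combination (hq - hQ)/32
  · have n1 : 3 + μ ≠ 0 := fun h => h9 (by linear_combination (μ-3)*h)
    have n2 : 3 - μ ≠ 0 := fun h => h9 (by linear_combination -(μ+3)*h)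
    have k1 := key μ hμ n1 n2
    have k2 := key (-μ) (by rw [neg_sq, hμ]) (by simpa [sub_eq_add_neg] using n2) (by simpa using n1)
    have k3 : μ*(μ^4+46*μ^2+81) = 0 := by linear_combination (k2-k1)/2
    rcases mul_eq_zero.1 k3 with h0 | hs
    · exfalso
      subst h0
      have : Q = 27/4 := by linear_combination k1/4
      rw [this] at e3
      norm_num at e3
    · obtain ⟨θ, hθ⟩ := IsAlgClosed.exists_pow_nat_eq ((-23-μ^2)/8) (n := 2) (by norm_num)
      have hθ4 : θ^4 = 7 := by
        have : θ^4 = (θ^2)^2 := by ring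
        rw [this, hθ]
        linear_combination hs/64
      refine Or.inr ⟨6, ?_⟩
      rw [ex6_eq]
      apply seven_diag θ a0 a1 a6 hθ4 ha1 ha6
      · rw [hθ]
        linear_combination hμ
      · rw [hθ]
        linear_combination -hQ + (k1+k2)/8 + 11/4*hs

theorem caseA1 (a0 a1 a6 : ℂ) : Good (sx a0 a1 0 1 0 0 a6) := by
  by_cases ha1 : a1 = 0
  · subst ha1
    by_cases ha6 : a6 = 0
    · subst ha6
      by_cases ha0 : a0 = 0
      · subst ha0
        obtain ⟨s, hs⟩ := IsAlgClosed.exists_pow_nat_eq (1/20 : ℂ) (n := 3) (by norm_num)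
        have hs0 : s ≠ 0 := by
          rintro rfl
          norm_num at hs
        refine Or.inr ⟨2, ?_⟩
        rw [ex2_eq]
        refine sx_equiv' s 0 0 1 (by simpa using hs0) ?_ ?_ ?_ ?_ ?_ ?_ ?_
        · simp only [sb0]; ring
        · simp only [sb1]; ring
        · simp only [sb2]; ring
        · simp only [sb3]; linear_combination hs
        · simp only [sb4]; ring
        · simp only [sb5]; ring
        · simp only [sb6]; ring
      · apply good_of_dsc a0 0 0 2 (-1)
        · refine ⟨?_, ?_, ?_, ?_⟩ <;> ring
        · simp [dsc, ha0]
    · obtain ⟨μ, hμ, hμ1⟩ : ∃ μ : ℂ, μ^2 = 1 - a0*a6 ∧ 1 + μ ≠ 0 := by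
        by_cases ha0 : a0 = 0
        · exact ⟨1, by rw [ha0]; ring, by norm_num⟩
        · obtain ⟨μ, hμ⟩ := IsAlgClosed.exists_pow_nat_eq (1 - a0*a6) (n := 2) (by norm_num)
          refine ⟨μ, hμ, fun h => ?_⟩
          have : a0*a6 = 0 := by linear_combination (1-μ)*h + hμ
          simp_all
      apply good_of_dsc (1+μ) 0 0 a6 μ
      · refine ⟨?_, ?_, ?_, ?_⟩
        · linear_combination -hμ
        · ring
        · ring
        · ring
      · simp [dsc, ha6, hμ1]
  · by_cases ha6 : a6 = 0
    · subst ha6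
      apply good_of_dsc (3*a1) 0 2 0 3
      · refine ⟨?_, ?_, ?_, ?_⟩ <;> ring
      · simp [dsc, ha1]
    · by_contra hG
      apply hG
      apply caseA_main a0 a1 a6 ha1 ha6
      intro c0 c1 c2 c3 l hE
      by_contra hd
      exact hG (good_of_dsc c0 c1 c2 c3 l hE hd)

theorem case5 (a0 a1 : ℂ) : Good (sx a0 a1 0 0 0 0 0) := by
  by_cases h : a1 = 0
  · subst h
    exact good_two a0 0
  · refine Or.inr ⟨3, ?_⟩
    rw [ex3_eq]
    refine sx_equiv' 1 0 (-a0/(6*a1)) (1/(6*a1)) ?_ ?_ ?_ ?_ ?_ ?_ ?_ ?_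
    · simpa using h
    · simp only [sb0]; field_simp; ring
    · simp only [sb1]; field_simp; ring
    · simp only [sb2]; ring
    · simp only [sb3]; ring
    · simp only [sb4]; ring
    · simp only [sb5]; ring
    · simp only [sb6]; ring

theorem caseA (a0 a1 a3 a6 : ℂ) : Good (sx a0 a1 0 a3 0 0 a6) := by
  by_cases h3 : a3 = 0
  · subst h3
    by_cases h6 : a6 = 0
    · subst h6
      exact case5 a0 a1
    by_cases h1 : a1 = 0
    · subst h1
      exact good_two a0 a6
    by_cases h0 : a0 = 0
    · subst h0
      obtain ⟨t, ht⟩ := IsAlgClosed.exists_pow_nat_eq (1/a6) (n := 6) (by norm_num)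
      have ht' : t^6*a6 = 1 := by
        rw [ht]
        field_simp
      have ht0 : t ≠ 0 := by
        rintro rfl
        norm_num at ht'
      obtain ⟨s, hs⟩ := IsAlgClosed.exists_pow_nat_eq (1/(6*a1*t)) (n := 5) (by norm_num)
      have hs' : s^5*t*a1 = 1/6 := by
        rw [hs]
        field_simp
      have hs0 : s ≠ 0 := by
        rintro rfl
        norm_num at hs'
      refine Or.inr ⟨4, ?_⟩
      rw [ex4_eq]
      refine sx_equiv' 0 s t 0 (by simp [hs0, ht0]) ?_ ?_ ?_ ?_ ?_ ?_ ?_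
      · simp only [sb0]; linear_combination ht'
      · simp only [sb1]; ring
      · simp only [sb2]; ring
      · simp only [sb3]; ring
      · simp only [sb4]; ring
      · simp only [sb5]; linear_combination hs'
      · simp only [sb6]; ring
    · by_contra hG
      obtain ⟨μ, hμ⟩ := IsAlgClosed.exists_pow_nat_eq (-a0*a6) (n := 2) (by norm_num)
      have key : ∀ ν : ℂ, ν^2 = -a0*a6 → ν^5 = 4*a1^3*a6^2 := by
        intro ν hν
        have hν0 : ν ≠ 0 := by
          rintro rfl
          have : a0*a6 = 0 := by linear_combination hν
          simp_all
        by_contra hne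
        apply hG
        apply good_of_dsc (ν^2) (-a1*a6) 0 (a6*ν) ν
        · refine ⟨?_, ?_, ?_, ?_⟩
          · linear_combination -ν*hν
          · ring
          · ring
          · ring
        · have : dsc (ν^2) (-a1*a6) 0 (a6*ν) = a6^2*ν*(ν^5 - 4*a1^3*a6^2) := by
            rw [dsc]
            ring
          rw [this]
          have := sub_ne_zero.2 hne
          positivity
      have k1 := key μ hμ
      have k2 := key (-μ) (by rw [neg_sq, hμ])
      have : a1^3*a6^2 = 0 := by linear_combination -(k1+k2)/8
      simp_all
  · obtain ⟨s, hs⟩ := IsAlgClosed.exists_pow_nat_eq (1/a3) (n := 3) (by norm_num)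
    have hs' : s^3*a3 = 1 := by
      rw [hs]
      field_simp
    have hs0 : s ≠ 0 := by
      rintro rfl
      norm_num at hs'
    refine Good.of_equiv (sx_equiv' s 0 0 1 (b0 := s^6*a0) (b1 := s^5*a1) (b2 := 0) (b3 := 1)
      (b4 := 0) (b5 := 0) (b6 := a6) (by simpa using hs0) ?_ ?_ ?_ ?_ ?_ ?_ ?_) (caseA1 _ _ _)
    · simp only [sb0]; ring
    · simp only [sb1]; ring
    · simp only [sb2]; ring
    · simp only [sb3]; linear_combination hs'
    · simp only [sb4]; ring
    · simp only [sb5]; ring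
    · simp only [sb6]; ring

theorem caseB (a0 a1 a2 a3 : ℂ) : Good (sx a0 a1 a2 a3 0 0 0) := by
  by_cases h3 : a3 = 0
  · subst h3
    by_cases h2 : a2 = 0
    · subst h2
      exact case5 a0 a1
    -- complete the square
    obtain ⟨t, ht⟩ : ∃ t, t * (5*a2) = -a1 := ⟨-a1/(5*a2), by field_simp⟩
    obtain ⟨s, hs⟩ := IsAlgClosed.exists_pow_nat_eq (1/(15*a2)) (n := 2) (by norm_num)
    have hs' : s^2*a2 = 1/15 := by
      rw [hs]
      field_simp
    have hs0 : s ≠ 0 := by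
      rintro rfl
      norm_num at hs'
    obtain ⟨e, he⟩ : ∃ e, e = a0 + 6*a1*t + 15*a2*t^2 := ⟨_, rfl⟩
    have hE : LinEquiv (sx a0 a1 a2 0 0 0 0) (sx e 0 (1/15) 0 0 0 0) := by
      refine sx_equiv' 1 0 t s (by simpa using hs0) ?_ ?_ ?_ ?_ ?_ ?_ ?_
      · simp only [sb0]; rw [he]; ring
      · simp only [sb1]; linear_combination s*ht
      · simp only [sb2]; linear_combination hs'
      · simp only [sb3]; ring
      · simp only [sb4]; ring
      · simp only [sb5]; ring
      · simp only [sb6]; ring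
    by_cases he0 : e = 0
    · refine Or.inr ⟨0, ?_⟩
      rw [ex0_eq]
      rwa [he0] at hE
    · refine Or.inr ⟨1, hE.trans' ?_⟩
      rw [ex1_eq]
      obtain ⟨p, hp⟩ := IsAlgClosed.exists_pow_nat_eq (1/e) (n := 6) (by norm_num)
      have hp' : p^6*e = 1 := by
        rw [hp]
        field_simp
      have hp0 : p ≠ 0 := by
        rintro rfl
        norm_num at hp'
      refine sx_equiv' p 0 0 (1/p^2) (by simp [hp0]) ?_ ?_ ?_ ?_ ?_ ?_ ?_
      · simp only [sb0]; linear_combination hp'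
      · simp only [sb1]; ring
      · simp only [sb2]; field_simp; ring
      · simp only [sb3]; ring
      · simp only [sb4]; ring
      · simp only [sb5]; ring
      · simp only [sb6]; ring
  · obtain ⟨t, ht⟩ : ∃ t, t * (4*a3) = -a2 := ⟨-a2/(4*a3), by field_simp⟩
    obtain ⟨b0, h0⟩ : ∃ b, sb0 1 0 t 1 a0 a1 a2 a3 0 0 0 = b := ⟨_, rfl⟩
    obtain ⟨b1, h1⟩ : ∃ b, sb1 1 0 t 1 a0 a1 a2 a3 0 0 0 = b := ⟨_, rfl⟩
    refine Good.of_equiv (sx_equiv' 1 0 t 1 (b0 := b0) (b1 := b1) (b2 := 0) (b3 := a3)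
      (b4 := 0) (b5 := 0) (b6 := 0) (by norm_num) h0 h1 ?_ ?_ ?_ ?_ ?_) (caseA _ _ _ _)
    · simp only [sb2]; linear_combination ht
    · simp only [sb3]; ring
    · simp only [sb4]; ring
    · simp only [sb5]; ring
    · simp only [sb6]; ring

theorem good_of_eig {a0 a1 a2 a3 a4 a5 a6 : ℂ} (c0 c1 c2 c3 l : ℂ)
    (h : Eig a0 a1 a2 a3 a4 a5 a6 c0 c1 c2 c3 l)
    (hc : ¬ (c0 = 0 ∧ c1 = 0 ∧ c2 = 0 ∧ c3 = 0)) :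
    Good (sx a0 a1 a2 a3 a4 a5 a6) := by
  by_cases hd : dsc c0 c1 c2 c3 ≠ 0
  · exact good_of_dsc c0 c1 c2 c3 l h hd
  obtain ⟨p, q, r, s, hdet, hN⟩ := red_all c0 c1 c2 c3 hc
  have hE := eig_transfer p q r s a0 a1 a2 a3 a4 a5 a6 c0 c1 c2 c3 l h
  refine Good.of_equiv (sx_equiv p q r s a0 a1 a2 a3 a4 a5 a6 hdet) ?_
  generalize sb0 p q r s a0 a1 a2 a3 a4 a5 a6 = b0 at *
  generalize sb1 p q r s a0 a1 a2 a3 a4 a5 a6 = b1 at *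
  generalize sb2 p q r s a0 a1 a2 a3 a4 a5 a6 = b2 at *
  generalize sb3 p q r s a0 a1 a2 a3 a4 a5 a6 = b3 at *
  generalize sb4 p q r s a0 a1 a2 a3 a4 a5 a6 = b4 at *
  generalize sb5 p q r s a0 a1 a2 a3 a4 a5 a6 = b5 at *
  generalize sb6 p q r s a0 a1 a2 a3 a4 a5 a6 = b6 at *
  generalize cb0 p q r s c0 c1 c2 c3 = d0 at *
  generalize cb1 p q r s c0 c1 c2 c3 = d1 at *
  generalize cb2 p q r s c0 c1 c2 c3 = d2 at *
  generalize cb3 p q r s c0 c1 c2 c3 = d3 at *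
  generalize l * (p*s-q*r)^3 = m at *
  rcases hN with ⟨h0, rfl, rfl, rfl⟩ | ⟨rfl, h1, rfl, rfl⟩ | ⟨rfl, h1, rfl, rfl⟩
  · obtain ⟨e0, e1, e2, e3⟩ := hE
    have f4 : b4 = 0 := mul_left_cancel₀ h0 (by linear_combination e1)
    have f5 : b5 = 0 := mul_left_cancel₀ h0 (by linear_combination e2)
    have f6 : b6 = 0 := mul_left_cancel₀ h0 (by linear_combination e3)
    rw [f4, f5, f6]
    exact caseB _ _ _ _
  · obtain ⟨e0, e1, e2, e3⟩ := hE
    have f2 : b2 = 0 := mul_left_cancel₀ h1 (by linear_combination -e0/3)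
    have f4 : b4 = 0 := mul_left_cancel₀ h1 (by linear_combination -e2/3)
    have f5 : b5 = 0 := mul_left_cancel₀ h1 (by linear_combination -e3/3)
    rw [f2, f4, f5]
    exact caseA _ _ _ _
  · apply good_of_dsc _ _ _ _ _ hE
    have : dsc 0 d1 0 (-3*d1) = -12*d1^4 := by
      rw [dsc]
      ring
    rw [this]
    simpa using h1

theorem exists_eig (a0 a1 a2 a3 a4 a5 a6 : ℂ) : ∃ c0 c1 c2 c3 l,
    Eig a0 a1 a2 a3 a4 a5 a6 c0 c1 c2 c3 l ∧ ¬ (c0 = 0 ∧ c1 = 0 ∧ c2 = 0 ∧ c3 = 0) := by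
  obtain ⟨l, hl⟩ := Module.End.exists_eigenvalue (Matrix.toLin'
    !![a3, -3*a2, 3*a1, -a0; a4, -3*a3, 3*a2, -a1; a5, -3*a4, 3*a3, -a2; a6, -3*a5, 3*a4, -a3])
  obtain ⟨v, hv⟩ := hl.exists_hasEigenvector
  have h := hv.apply_eq_smul
  rw [Matrix.toLin'_apply] at h
  have h0 := congrFun h 0
  have h1 := congrFun h 1
  have h2 := congrFun h 2
  have h3 := congrFun h 3
  simp [Matrix.mulVec, dotProduct, Fin.sum_univ_four] at h0 h1 h2 h3
  refine ⟨v 0, v 1, v 2, v 3, l, ⟨?_, ?_, ?_, ?_⟩, ?_⟩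
  · linear_combination h0
  · linear_combination h1
  · linear_combination h2
  · linear_combination h3
  · rintro ⟨z0, z1, z2, z3⟩
    apply hv.2
    ext i
    fin_cases i <;> simp [z0, z1, z2, z3]

/-- Every binary sextic is linearly equivalent either to a sextic in
Sylvester Canonical Form or to one of the seven exceptional sextics. -/
theorem sextic_canonical_form (Q : MvPolynomial (Fin 2) ℂ) (hQ : Q.IsHomogeneous 6) :
    (∃ S, IsSylvester S ∧ LinEquiv Q S) ∨ (∃ i : Fin 7, LinEquiv Q (exceptionalSextic i)) := by
  obtain ⟨a0, a1, a2, a3, a4, a5, a6, rfl⟩ := exists_sx Q hQ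
  obtain ⟨c0, c1, c2, c3, l, hE, hc⟩ := exists_eig a0 a1 a2 a3 a4 a5 a6
  exact good_of_eig c0 c1 c2 c3 l hE hc
end
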